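/- Fix q > 0. For every λ > 0, lim_{n→∞} (1/n) log Z_{n,λ,q}[L] = Ψ(λ/q) − ((q−1)/(2q))λ + log q, and moreover lim_{r→∞} lim_{n→∞} (1/n) log Z_{n,λ,q}[B_r ∩ L] equals the same value. The convergence is uniform for λ belonging to compact subsets of (0,∞)∖{q}. -/

import Mathlib

open Filter Topology Set

noncomputable section

/-- Size of the connected component of `K_n(ω)` containing the vertex `v`. -/
def compSize {n : ℕ} (G : SimpleGraph (Fin n)) (v : Fin n) : ℕ :=
  (G.connectedComponentMk v).supp.ncard

/-- Random cluster weight of a configuration `G` on the complete graph `K_m`,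
with edge weight `p` and cluster weight `q`. -/
def rcW (m : ℕ) (p q : ℝ) (G : SimpleGraph (Fin m)) : ℝ :=
  p ^ G.edgeSet.ncard * (1 - p) ^ (m * (m - 1) / 2 - G.edgeSet.ncard) *
    q ^ Nat.card G.ConnectedComponent

/-- Total random-cluster weight of an event, with explicit edge weight `p`. -/
def ZP (m : ℕ) (p q : ℝ) (A : Set (SimpleGraph (Fin m))) : ℝ :=
  ∑ᶠ G ∈ A, rcW m p q G

/-- `Z_{n,λ,q}[A]`, i.e. the total weight of the event `A` with `p = λ/n`. -/
def Zrc (n : ℕ) (lam q : ℝ) (A : Set (SimpleGraph (Fin n))) : ℝ :=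
  ZP n (lam / n) q A

/-- The partition function `Z_{n,λ,q}`. -/
def Ztot (n : ℕ) (lam q : ℝ) : ℝ := Zrc n lam q Set.univ

/-- The random cluster probability `φ_{n,λ,q}[A]`. -/
def phiRC (n : ℕ) (lam q : ℝ) (A : Set (SimpleGraph (Fin n))) : ℝ :=
  Zrc n lam q A / Ztot n lam q

/-- The event `K` that the configuration is connected. -/
def Kev (n : ℕ) : Set (SimpleGraph (Fin n)) := {G | G.Connected}

/-- The event `B_r` that no connected component has size larger than `r`. -/
def Bev (n : ℕ) (r : ℝ) : Set (SimpleGraph (Fin n)) :=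
  {G | ∀ v, (compSize G v : ℝ) ≤ r}

/-- The event `L` that the configuration is acyclic. -/
def Lev (n : ℕ) : Set (SimpleGraph (Fin n)) := {G | G.IsAcyclic}

/-- The set `V_r` of vertices lying in components of size larger than `r`. -/
def Vbig {n : ℕ} (G : SimpleGraph (Fin n)) (r : ℝ) : Set (Fin n) :=
  {v | r < (compSize G v : ℝ)}

/-- The number `N_r` of connected components of size larger than `r`. -/
def Nbig {n : ℕ} (G : SimpleGraph (Fin n)) (r : ℝ) : ℕ :=
  {C : G.ConnectedComponent | r < (C.supp.ncard : ℝ)}.ncard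

def pi1 (x : ℝ) : ℝ := 1 - Real.exp (-x)

def Psi (x : ℝ) : ℝ := min (Real.log x - (x - 1/x) / 2) 0

def Sent (θ : ℝ) : ℝ := θ * Real.log θ + (1 - θ) * Real.log (1 - θ)

def Phi (θ lam q : ℝ) : ℝ :=
  -Sent θ + (1 - θ) * Real.log (1 - pi1 (lam * θ)) + θ * Real.log (pi1 (lam * θ)) +
    (1 - θ) * (Psi (lam * (1 - θ) / q) - ((q - 1) / (2 * q)) * (lam * (1 - θ)) + Real.log q)

open SimpleGraph in
lemma reach_sup_edge {V : Type*} {F : SimpleGraph V} {u v a b : V} :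
    (F ⊔ edge u v).Reachable a b ↔ F.Reachable a b ∨ (F.Reachable a u ∧ F.Reachable v b) ∨
      (F.Reachable a v ∧ F.Reachable u b) := by
  constructor
  · rintro ⟨p⟩
    induction p with
    | nil => exact Or.inl (Reachable.refl _)
    | @cons x y z h p ih =>
      have h' : F.Adj x y ∨ (x = u ∧ y = v) ∨ (x = v ∧ y = u) := by
        rw [sup_adj, edge_adj] at h
        tauto
      rcases h' with h' | ⟨rfl, rfl⟩ | ⟨rfl, rfl⟩
      · have := h'.reachable
        rcases ih with h | ⟨h1, h2⟩ | ⟨h1, h2⟩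
        · exact Or.inl (this.trans h)
        · exact Or.inr (Or.inl ⟨this.trans h1, h2⟩)
        · exact Or.inr (Or.inr ⟨this.trans h1, h2⟩)
      · rcases ih with h | ⟨h1, h2⟩ | ⟨h1, h2⟩
        · exact Or.inr (Or.inl ⟨Reachable.refl _, h⟩)
        · exact Or.inr (Or.inl ⟨Reachable.refl _, h2⟩)
        · exact Or.inl h2
      · rcases ih with h | ⟨h1, h2⟩ | ⟨h1, h2⟩
        · exact Or.inr (Or.inr ⟨Reachable.refl _, h⟩)
        · exact Or.inl h2
        · exact Or.inr (Or.inr ⟨Reachable.refl _, h2⟩)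
  · have hle : F ≤ F ⊔ edge u v := le_sup_left
    have huv : (F ⊔ edge u v).Reachable u v := by
      by_cases h : u = v
      · rw [h]
      · apply Adj.reachable
        rw [sup_adj, edge_adj]
        tauto
    rintro (h | ⟨h1, h2⟩ | ⟨h1, h2⟩)
    · exact h.mono hle
    · exact (h1.mono hle).trans (huv.trans (h2.mono hle))
    · exact (h1.mono hle).trans (huv.symm.trans (h2.mono hle))

/-- number of connected components -/
def cc {V : Type*} (F : SimpleGraph V) : ℕ := Nat.card F.ConnectedComponent

open SimpleGraph in
lemma cc_sup_edge {V : Type*} [Finite V] {F : SimpleGraph V} {u v : V} (h : ¬ F.Reachable u v) :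
    cc (F ⊔ edge u v) + 1 = cc F := by
  classical
  have hle : F ≤ F ⊔ edge u v := le_sup_left
  let f : {C : F.ConnectedComponent // C ≠ F.connectedComponentMk u} →
      (F ⊔ edge u v).ConnectedComponent := fun C => C.1.map (Hom.ofLE hle)
  have hf : Function.Bijective f := by
    constructor
    · rintro ⟨C, hC⟩ ⟨D, hD⟩ hCD
      induction C using ConnectedComponent.ind with | h a
      induction D using ConnectedComponent.ind with | h b
      have : (F ⊔ edge u v).Reachable a b := ConnectedComponent.exact hCD
      rw [reach_sup_edge] at this
      have ha : ¬ F.Reachable a u := fun hh => hC (ConnectedComponent.sound hh)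
      have hb : ¬ F.Reachable u b := fun hh => hD (ConnectedComponent.sound hh.symm)
      have : F.Reachable a b := by tauto
      exact Subtype.ext (ConnectedComponent.sound this)
    · intro C
      induction C using ConnectedComponent.ind with | h a
      by_cases ha : F.Reachable a u
      · refine ⟨⟨F.connectedComponentMk v, fun hh => h (ConnectedComponent.exact hh).symm⟩, ?_⟩
        refine ConnectedComponent.sound (G := F ⊔ edge u v) (v := v) (w := a) ?_
        rw [reach_sup_edge]
        exact Or.inr (Or.inr ⟨Reachable.refl _, ha.symm⟩)
      · exact ⟨⟨F.connectedComponentMk a, fun hh => ha (ConnectedComponent.exact hh)⟩, rfl⟩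
  have h1 := Nat.card_congr (Equiv.ofBijective f hf)
  have h2 : Nat.card {C : F.ConnectedComponent // C ≠ F.connectedComponentMk u} + 1 = cc F := by
    have := Fintype.ofFinite F.ConnectedComponent
    rw [cc, Nat.card_eq_fintype_card, Nat.card_eq_fintype_card]
    rw [Fintype.card_subtype_compl]
    simp
    have : 0 < Fintype.card F.ConnectedComponent := Fintype.card_pos_iff.2 ⟨F.connectedComponentMk u⟩
    omega
  rw [← h2, h1, cc]

open SimpleGraph in
lemma ncard_sup_edge {V : Type*} [Finite V] {F : SimpleGraph V} {u v : V} (h : ¬ F.Reachable u v) :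
    (F ⊔ edge u v).edgeSet.ncard = F.edgeSet.ncard + 1 := by
  have hne : u ≠ v := by rintro rfl; exact h (Reachable.refl _)
  have hadj : ¬ F.Adj u v := fun hh => h hh.reachable
  have : (F ⊔ edge u v).edgeSet = insert s(u,v) F.edgeSet := by
    rw [edgeSet_sup, edgeSet_edge_of_ne hne, Set.union_singleton]
  rw [this, Set.ncard_insert_of_notMem]
  simpa using hadj

open SimpleGraph in
lemma forest_card {V : Type*} [Finite V] {F : SimpleGraph V} (hF : F.IsAcyclic) :
    cc F + F.edgeSet.ncard = Nat.card V := by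
  generalize hk : cc F = k
  induction k using Nat.strong_induction_on generalizing F with
  | _ k ih =>
  by_cases hp : F.Preconnected
  · rcases isEmpty_or_nonempty V with hV | hV
    · have : F.edgeSet = ∅ := by
        ext e; induction e with | h x y => exact isEmptyElim x
      have h2 : cc F = 0 := by
        rw [cc, Nat.card_eq_zero]; left
        exact ⟨fun C => by induction C using ConnectedComponent.ind with | h a => exact isEmptyElim a⟩
      simp [this]; omega
    · have ht : F.IsTree := ⟨⟨hp⟩, hF⟩
      classical
      have := Fintype.ofFinite V
      have h1 := ht.card_edgeFinset
      have hs := hp.subsingleton_connectedComponent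
      have h2 : cc F = 1 := by
        rw [cc, Nat.card_eq_one_iff_unique]
        exact ⟨hs, ⟨F.connectedComponentMk (Classical.arbitrary V)⟩⟩
      rw [← coe_edgeFinset, Set.ncard_coe_finset, Nat.card_eq_fintype_card]
      omega
  · unfold Preconnected at hp
    push Not at hp
    obtain ⟨u, v, huv⟩ := hp
    have h1 := cc_sup_edge huv
    have h2 := ncard_sup_edge huv
    have := ih _ (by omega) (hF.sup_edge_of_not_reachable huv) rfl
    omega

def Transv {n : ℕ} (F : SimpleGraph (Fin n)) (S : Finset (Fin n)) : Prop :=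
  ∀ v, ∃ s ∈ S, F.Reachable v s ∧ ∀ t ∈ S, F.Reachable v t → t = s

lemma Transv.card {n : ℕ} {F : SimpleGraph (Fin n)} {S : Finset (Fin n)} (h : Transv F S) :
    S.card = cc F := by
  have hf : Function.Bijective (fun s : S => F.connectedComponentMk s.1) := by
    constructor
    · rintro ⟨a, ha⟩ ⟨b, hb⟩ hab
      have : F.Reachable a b := SimpleGraph.ConnectedComponent.exact hab
      obtain ⟨s, hs, h1, h2⟩ := h a
      have := h2 a ha (SimpleGraph.Reachable.refl _)
      have := h2 b hb ‹_›
      apply Subtype.ext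
      simp_all
    · intro C
      induction C using SimpleGraph.ConnectedComponent.ind with | h a
      obtain ⟨s, hs, h1, h2⟩ := h a
      exact ⟨⟨s, hs⟩, SimpleGraph.ConnectedComponent.sound h1.symm⟩
  rw [cc, ← Nat.card_congr (Equiv.ofBijective _ hf)]
  simp

open Classical in
def RF (n k : ℕ) : Finset (SimpleGraph (Fin n) × Finset (Fin n)) :=
  Finset.univ.filter fun p => p.1.IsAcyclic ∧ Transv p.1 p.2 ∧ p.2.card = k

lemma mem_RF {n k : ℕ} {p : SimpleGraph (Fin n) × Finset (Fin n)} :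
    p ∈ RF n k ↔ p.1.IsAcyclic ∧ Transv p.1 p.2 ∧ p.2.card = k := by
  simp [RF]

open Classical in
lemma RF_rec (n k : ℕ) (hkn : k + 1 ≤ n) :
    (RF n (k+1)).card * (n * k) ≤ (RF n k).card * (n - k) := by
  let X : Finset (Σ _ : SimpleGraph (Fin n) × Finset (Fin n), Σ _ : Fin n, Fin n) :=
    (RF n (k+1)).sigma fun p => Finset.univ.sigma fun w => p.2.filter fun s => ¬ p.1.Reachable w s
  let Y : Finset (Σ _ : SimpleGraph (Fin n) × Finset (Fin n), Sym2 (Fin n)) :=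
    (RF n k).sigma fun p => p.1.edgeFinset
  have hX : X.card = (RF n (k+1)).card * (n * k) := by
    rw [Finset.card_sigma, Finset.sum_const_nat]
    intro p hp
    rw [mem_RF] at hp
    rw [Finset.card_sigma, Finset.sum_const_nat (m := k)]
    · simp
    intro w _
    obtain ⟨s, hs, h1, h2⟩ := hp.2.1 w
    have : p.2.filter (fun s => ¬ p.1.Reachable w s) = p.2.erase s := by
      ext t
      simp only [Finset.mem_filter, Finset.mem_erase]
      constructor
      · rintro ⟨ht, h⟩
        exact ⟨by rintro rfl; exact h h1, ht⟩
      · rintro ⟨ht, h⟩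
        exact ⟨h, fun hh => ht (h2 t h hh)⟩
    rw [this, Finset.card_erase_of_mem hs, hp.2.2]
    rfl
  have hY : Y.card = (RF n k).card * (n - k) := by
    rw [Finset.card_sigma, Finset.sum_const_nat]
    intro p hp
    rw [mem_RF] at hp
    have h1 := forest_card hp.1
    have h2 := hp.2.1.card
    rw [← SimpleGraph.coe_edgeFinset, Set.ncard_coe_finset, Nat.card_eq_fintype_card,
      Fintype.card_fin] at h1
    omega
  rw [← hX, ← hY]
  apply Finset.card_le_card_of_injOn
    (fun z => ⟨(z.1.1 ⊔ SimpleGraph.edge z.2.1 z.2.2, z.1.2.erase z.2.2), s(z.2.1, z.2.2)⟩)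
  · rintro ⟨⟨F, S⟩, ⟨w, s⟩⟩ hz
    simp only [X, Finset.coe_sigma, Set.mem_sigma_iff, Finset.mem_coe, mem_RF, Finset.mem_filter,
      Finset.mem_univ, true_and] at hz
    obtain ⟨⟨hF, hT, hc⟩, hs, hr⟩ := hz
    have hne : w ≠ s := by rintro rfl; exact hr (SimpleGraph.Reachable.refl _)
    simp only [Y, Finset.coe_sigma, Set.mem_sigma_iff, Finset.mem_coe, mem_RF]
    refine ⟨⟨hF.sup_edge_of_not_reachable hr, ?_, ?_⟩, ?_⟩
    · intro v
      obtain ⟨a, ha, h1, h2⟩ := hT v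
      obtain ⟨b, hb, h3, h4⟩ := hT w
      have hss : ∀ t ∈ S, F.Reachable s t → t = s := by
        intro t ht hst
        obtain ⟨c, hc, h5, h6⟩ := hT s
        rw [h6 t ht hst, h6 s hs (SimpleGraph.Reachable.refl _)]
      have hbs : b ≠ s := by rintro rfl; exact hr h3
      by_cases has : a = s
      · subst has
        refine ⟨b, by simp [hb, hbs], ?_, ?_⟩
        · rw [reach_sup_edge]; exact Or.inr (Or.inr ⟨h1, h3⟩)
        · intro t ht hvt
          rw [Finset.mem_erase] at ht
          rw [reach_sup_edge] at hvt
          rcases hvt with h | ⟨h, h'⟩ | ⟨h, h'⟩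
          · exact absurd (h2 t ht.2 h) ht.1
          · exact absurd (hss t ht.2 h') ht.1
          · exact h4 t ht.2 h'
      · refine ⟨a, by simp [ha, has], ?_, ?_⟩
        · rw [reach_sup_edge]; exact Or.inl h1
        · intro t ht hvt
          rw [Finset.mem_erase] at ht
          rw [reach_sup_edge] at hvt
          rcases hvt with h | ⟨h, h'⟩ | ⟨h, h'⟩
          · exact h2 t ht.2 h
          · exact absurd (hss t ht.2 h') ht.1
          · exact absurd (h2 s hs h).symm has
    · simp only [Finset.card_erase_of_mem hs, hc]; rfl
    · simp [hne]
  · rintro ⟨⟨F, S⟩, ⟨w, s⟩⟩ hz ⟨⟨F', S'⟩, ⟨w', s'⟩⟩ hz' heq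
    simp only [X, Finset.coe_sigma, Set.mem_sigma_iff, Finset.mem_coe, mem_RF, Finset.mem_filter,
      Finset.mem_univ, true_and] at hz hz'
    obtain ⟨⟨hF, hT, hc⟩, hs, hr⟩ := hz
    obtain ⟨⟨hF', hT', hc'⟩, hs', hr'⟩ := hz'
    simp only [Sigma.mk.injEq, Prod.mk.injEq, heq_eq_eq] at heq
    obtain ⟨⟨hFF, hSS⟩, hee⟩ := heq
    have key : ∀ (F : SimpleGraph (Fin n)) w s, ¬ F.Reachable w s →
        F = (F ⊔ SimpleGraph.edge w s).deleteEdges {s(w,s)} := by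
      intro F w s hr
      have hadj : ¬ F.Adj w s := fun h => hr h.reachable
      ext x y
      simp only [SimpleGraph.deleteEdges_adj, SimpleGraph.sup_adj, SimpleGraph.edge_adj,
        Set.mem_singleton_iff]
      constructor
      · intro h
        refine ⟨Or.inl h, fun h' => ?_⟩
        rw [← SimpleGraph.mem_edgeSet, h', SimpleGraph.mem_edgeSet] at h
        exact hadj h
      · rintro ⟨h | ⟨⟨rfl, rfl⟩ | ⟨rfl, rfl⟩, h⟩, h'⟩
        · exact h
        · exact absurd rfl h'
        · exact absurd Sym2.eq_swap h'
    have hFF' : F = F' := by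
      rw [key F w s hr, key F' w' s' hr', hFF, hee]
    subst hFF'
    rw [Sym2.eq_iff] at hee
    rcases hee with ⟨rfl, rfl⟩ | ⟨rfl, rfl⟩
    · have : S = S' := by
        rw [← Finset.insert_erase hs, ← Finset.insert_erase hs', hSS]
      subst this
      rfl
    · exfalso
      obtain ⟨b, hb, h3, h4⟩ := hT w
      have hbs : b ≠ s := by rintro rfl; exact hr h3
      have hbS : b ∈ S'.erase w := by rw [← hSS]; simp [hb, hbs]
      obtain ⟨c, hc, h5, h6⟩ := hT' w
      rw [Finset.mem_erase] at hbS
      have e1 := h6 b hbS.2 h3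
      have e2 := h6 w hs' (SimpleGraph.Reachable.refl _)
      exact hbS.1 (e1.trans e2.symm)

lemma RF_lower (n j : ℕ) (hj : j + 1 ≤ n) : n ^ j * (n-1).choose j ≤ (RF n (n - j)).card := by
  induction j with
  | zero =>
    simp only [pow_zero, Nat.choose_zero_right, mul_one, Nat.sub_zero]
    rw [Nat.one_le_iff_ne_zero, ← Nat.pos_iff_ne_zero, Finset.card_pos]
    refine ⟨(⊥, Finset.univ), mem_RF.2 ⟨SimpleGraph.isAcyclic_bot, ?_, by simp⟩⟩
    intro v
    refine ⟨v, by simp, SimpleGraph.Reachable.refl _, fun t _ h => ?_⟩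
    simpa using h.symm
  | succ j ih =>
    have h1 := ih (by omega)
    have h2 := RF_rec n (n - (j+1)) (by omega)
    have e1 : n - (j+1) + 1 = n - j := by omega
    have e2 : n - (n - (j+1)) = j + 1 := by omega
    rw [e1, e2] at h2
    have h3 := Nat.choose_succ_right_eq (n-1) j
    have e3 : n - 1 - j = n - (j+1) := by omega
    rw [e3] at h3
    apply Nat.le_of_mul_le_mul_right (c := j+1) _ (by omega)
    calc n ^ (j+1) * (n-1).choose (j+1) * (j+1)
        = n ^ j * n * ((n-1).choose (j+1) * (j+1)) := by ring
      _ = (n ^ j * (n-1).choose j) * (n * (n-(j+1))) := by rw [h3]; ring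
      _ ≤ (RF n (n-j)).card * (n * (n-(j+1))) := Nat.mul_le_mul_right _ h1
      _ ≤ _ := h2

/-- Forest generating polynomial with restriction `a` on the component sizes. -/
def good {n : ℕ} (a : ℕ → Prop) (F : SimpleGraph (Fin n)) : Prop :=
  F.IsAcyclic ∧ ∀ v, a (compSize F v)

open Classical in
def FG (a : ℕ → Prop) (n : ℕ) (x : ℝ) : ℝ :=
  ∑ F : SimpleGraph (Fin n) with good a F, x ^ cc F

lemma tree_lower (n : ℕ) (hn : 1 ≤ n) (x : ℝ) (hx : 0 ≤ x) :
    (n:ℝ) ^ (n-1) * x ≤ n * FG (fun _ => True) n x := by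
  classical
  have h := RF_lower n (n-1) (by omega)
  rw [Nat.choose_self, mul_one] at h
  have e : n - (n-1) = 1 := by omega
  rw [e] at h
  let Y : Finset (SimpleGraph (Fin n) × Fin n) :=
    (Finset.univ.filter fun F : SimpleGraph (Fin n) => F.IsAcyclic ∧ cc F = 1) ×ˢ Finset.univ
  have h2 : (RF n 1).card ≤ Y.card := by
    have : RF n 1 ⊆ Y.image (fun p => (p.1, {p.2})) := by
      rintro ⟨F, S⟩ hp
      rw [mem_RF] at hp
      obtain ⟨h1, h2, h3⟩ := hp
      obtain ⟨s, rfl⟩ := Finset.card_eq_one.1 h3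
      rw [Finset.mem_image]
      refine ⟨(F, s), ?_, rfl⟩
      have := h2.card
      simp [Y, h1, ← this]
    exact (Finset.card_le_card this).trans Finset.card_image_le
  have h3 : (Y.card : ℝ) * x ≤ n * FG (fun _ => True) n x := by
    rw [Finset.card_product, Finset.card_univ, Fintype.card_fin]
    push_cast
    rw [mul_comm _ (n:ℝ), mul_assoc]
    apply mul_le_mul_of_nonneg_left _ (by positivity)
    rw [← nsmul_eq_mul, ← Finset.sum_const]
    calc _ = ∑ F : SimpleGraph (Fin n) with F.IsAcyclic ∧ cc F = 1, x ^ cc F := by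
            apply Finset.sum_congr rfl
            intro F hF
            rw [Finset.mem_filter] at hF
            rw [hF.2.2, pow_one]
      _ ≤ _ := by
            apply Finset.sum_le_sum_of_subset_of_nonneg
            · intro F hF
              rw [Finset.mem_filter] at hF ⊢
              exact ⟨hF.1, hF.2.1, fun _ => trivial⟩
            · intros; positivity
  refine le_trans ?_ h3
  apply mul_le_mul_of_nonneg_right _ hx
  exact_mod_cast h.trans h2

lemma graph_tot (n : ℕ) (y : ℝ) :
    ∑ G : SimpleGraph (Fin n), y ^ G.edgeSet.ncard = (1 + y) ^ (n.choose 2) := by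
  classical
  have h := Finset.sum_pow_mul_eq_add_pow y 1 (⊤ : SimpleGraph (Fin n)).edgeFinset
  rw [SimpleGraph.card_edgeFinset_top_eq_card_choose_two, Fintype.card_fin] at h
  rw [add_comm, ← h]
  refine Finset.sum_bij' (fun G _ => G.edgeFinset) (fun s _ => SimpleGraph.fromEdgeSet (s : Set _))
    ?_ ?_ ?_ ?_ ?_
  · intro G _
    rw [Finset.mem_powerset]
    exact SimpleGraph.edgeFinset_mono le_top
  · simp
  · intro G _
    simp
  · intro s hs
    rw [Finset.mem_powerset] at hs
    ext e
    simp only [SimpleGraph.mem_edgeFinset, SimpleGraph.edgeSet_fromEdgeSet]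
    constructor
    · intro h; simpa using h.1
    · intro h
      refine ⟨by simpa using h, ?_⟩
      have := hs h
      simpa using this
  · intro G _
    rw [one_pow, mul_one, ← SimpleGraph.coe_edgeFinset, Set.ncard_coe_finset]

lemma edge_mod {n : ℕ} (a b : SimpleGraph (Fin n)) :
    (a ⊓ b).edgeSet.ncard + (a ⊔ b).edgeSet.ncard = a.edgeSet.ncard + b.edgeSet.ncard := by
  rw [SimpleGraph.edgeSet_inf, SimpleGraph.edgeSet_sup, add_comm]
  exact Set.ncard_union_add_ncard_inter _ _

open Classical in
lemma single_lower {n : ℕ} (y : ℝ) (hy : 0 < y) (D : SimpleGraph (Fin n)) :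
    (1 - y ^ D.edgeSet.ncard) * (∑ G : SimpleGraph (Fin n), y ^ G.edgeSet.ncard) ≤
      ∑ G : SimpleGraph (Fin n), y ^ G.edgeSet.ncard * (if D ≤ G then 0 else 1) := by
  have h1 : ∑ G : SimpleGraph (Fin n) with D ≤ G, y ^ G.edgeSet.ncard ≤
      y ^ D.edgeSet.ncard * (∑ G : SimpleGraph (Fin n), y ^ G.edgeSet.ncard) := by
    have e1 : ∑ G : SimpleGraph (Fin n) with D ≤ G, y ^ G.edgeSet.ncard =
        ∑ G : SimpleGraph (Fin n) with D ≤ G, y ^ D.edgeSet.ncard * y ^ (G \ D).edgeSet.ncard := by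
      apply Finset.sum_congr rfl
      intro G hG
      rw [Finset.mem_filter] at hG
      rw [← pow_add]
      congr 1
      have := edge_mod D (G \ D)
      rw [inf_sdiff_self_right, sup_sdiff_cancel_right hG.2] at this
      simpa using this
    rw [e1, ← Finset.mul_sum]
    apply mul_le_mul_of_nonneg_left _ (by positivity)
    rw [← Finset.sum_image (g := fun G : SimpleGraph (Fin n) => G \ D)
      (f := fun G => y ^ G.edgeSet.ncard)]
    · apply Finset.sum_le_sum_of_subset_of_nonneg (Finset.subset_univ _)
      intros; positivity
    · intro G hG G' hG' h
      rw [Finset.mem_coe, Finset.mem_filter] at hG hG'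
      simp only at h
      rw [← sup_sdiff_cancel_right hG.2, ← sup_sdiff_cancel_right hG'.2, h]
  have h2 : ∑ G : SimpleGraph (Fin n), y ^ G.edgeSet.ncard * (if D ≤ G then (0:ℝ) else 1) =
      (∑ G : SimpleGraph (Fin n), y ^ G.edgeSet.ncard) -
        ∑ G : SimpleGraph (Fin n) with D ≤ G, y ^ G.edgeSet.ncard := by
    rw [Finset.sum_filter, ← Finset.sum_sub_distrib]
    apply Finset.sum_congr rfl
    intro G _
    split_ifs <;> simp
  rw [h2]
  linarith

open Classical in
lemma family_lower {n : ℕ} {ι : Type*} (s : Finset ι) (y : ℝ) (hy : 0 < y) (hy1 : y ≤ 1)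
    (D : ι → SimpleGraph (Fin n)) :
    (∏ i ∈ s, (1 - y ^ (D i).edgeSet.ncard)) * (∑ G : SimpleGraph (Fin n), y ^ G.edgeSet.ncard) ≤
      ∑ G : SimpleGraph (Fin n), y ^ G.edgeSet.ncard * (∏ i ∈ s, if D i ≤ G then 0 else 1) := by
  induction s using Finset.induction_on with
  | empty => simp
  | insert i s his ih =>
    set T : ℝ := ∑ G : SimpleGraph (Fin n), y ^ G.edgeSet.ncard with hT
    have hTpos : 0 < T := Finset.sum_pos (fun _ _ => by positivity) Finset.univ_nonempty
    have h1 := single_lower y hy (D i)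
    have hf : Antitone (fun G : SimpleGraph (Fin n) => if D i ≤ G then (0:ℝ) else 1) := by
      intro G G' h
      simp only
      split_ifs with h1 h2
      · rfl
      · norm_num
      · exact absurd (‹D i ≤ G›.trans h) h1
      · rfl
    have hg : Antitone (fun G : SimpleGraph (Fin n) => ∏ j ∈ s, if D j ≤ G then (0:ℝ) else 1) := by
      intro G G' h
      apply Finset.prod_le_prod
      · intro j _; split_ifs <;> norm_num
      · intro j _
        split_ifs with h1 h2
        · rfl
        · norm_num
        · exact absurd (‹D j ≤ G›.trans h) h1
        · rfl
    have hk := fkg (α := (SimpleGraph (Fin n))ᵒᵈ) (β := ℝ)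
      (μ := fun G => y ^ (OrderDual.ofDual G).edgeSet.ncard)
      (f := fun G => if D i ≤ OrderDual.ofDual G then (0:ℝ) else 1)
      (g := fun G => ∏ j ∈ s, if D j ≤ OrderDual.ofDual G then (0:ℝ) else 1)
      (fun G => by positivity) (fun G => by dsimp; split_ifs <;> norm_num)
      (fun G => Finset.prod_nonneg fun j _ => by split_ifs <;> norm_num)
      (fun a b h => hf h) (fun a b h => hg h)
      (fun a b => by
        rw [← pow_add, ← pow_add]
        apply le_of_eq
        congr 1
        have := edge_mod (OrderDual.ofDual a) (OrderDual.ofDual b)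
        rw [← this, add_comm]
        rfl)
    have hk' : (∑ G : SimpleGraph (Fin n), y ^ G.edgeSet.ncard * (if D i ≤ G then (0:ℝ) else 1)) *
        (∑ G : SimpleGraph (Fin n), y ^ G.edgeSet.ncard * (∏ j ∈ s, if D j ≤ G then (0:ℝ) else 1)) ≤
        T * ∑ G : SimpleGraph (Fin n), y ^ G.edgeSet.ncard *
          ((if D i ≤ G then (0:ℝ) else 1) * ∏ j ∈ s, if D j ≤ G then (0:ℝ) else 1) := hk
    have hp : 0 ≤ ∏ j ∈ s, (1 - y ^ (D j).edgeSet.ncard) :=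
      Finset.prod_nonneg fun j _ => sub_nonneg.2 (pow_le_one₀ hy.le hy1)
    have hq : 0 ≤ 1 - y ^ (D i).edgeSet.ncard := sub_nonneg.2 (pow_le_one₀ hy.le hy1)
    simp_rw [Finset.prod_insert his]
    apply le_of_mul_le_mul_left _ hTpos
    refine le_trans ?_ hk'
    calc _ = ((1 - y ^ (D i).edgeSet.ncard) * T) * ((∏ j ∈ s, (1 - y ^ (D j).edgeSet.ncard)) * T) := by
            ring
      _ ≤ _ := mul_le_mul h1 ih (mul_nonneg hp hTpos.le) ((mul_nonneg hq hTpos.le).trans h1)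

lemma cycle_edges (k : ℕ) (hk : 3 ≤ k) {n : ℕ} (c : Fin k ↪ Fin n) :
    ((SimpleGraph.cycleGraph k).map c).edgeSet.ncard = k := by
  classical
  obtain ⟨m, rfl⟩ : ∃ m, k = m + 3 := ⟨k - 3, by omega⟩
  have h2 := SimpleGraph.sum_degrees_eq_twice_card_edges (SimpleGraph.cycleGraph (m+3))
  simp only [SimpleGraph.cycleGraph_degree_three_le, Finset.sum_const, Finset.card_univ,
    Fintype.card_fin, smul_eq_mul] at h2
  have h4 := SimpleGraph.edgeSet_map c (SimpleGraph.cycleGraph (m+3))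
  rw [h4, Set.ncard_image_of_injective _ c.sym2Map.injective, ← SimpleGraph.coe_edgeFinset,
    Set.ncard_coe_finset]
  omega

lemma one_sub_ge_exp {t : ℝ} (h0 : 0 ≤ t) (h1 : t ≤ 1/2) : Real.exp (-(2*t)) ≤ 1 - t := by
  rw [Real.exp_neg]
  have := Real.add_one_le_exp (2*t)
  rw [inv_le_comm₀ (Real.exp_pos _) (by linarith)]
  refine le_trans ?_ this
  rw [inv_le_comm₀ (by linarith) (by linarith), inv_le_iff_one_le_mul₀ (by linarith)]
  nlinarith

open Classical in
lemma forest_lower (n : ℕ) (hn : 2 ≤ n) (y : ℝ) (hy : 0 < y) (hny : n * y < 1) :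
    Real.exp (-(2 * (1 - n * y)⁻¹)) * (1 + y) ^ (n.choose 2) ≤
      ∑ F : SimpleGraph (Fin n) with F.IsAcyclic, y ^ F.edgeSet.ncard := by
  have hn' : (2:ℝ) ≤ n := by exact_mod_cast hn
  have hy2 : y ≤ 1/2 := by nlinarith
  let s : Finset (Σ k : ℕ, (Fin k ↪ Fin n)) :=
    (Finset.Icc 3 n).sigma fun k => Finset.univ
  let D : (Σ k : ℕ, (Fin k ↪ Fin n)) → SimpleGraph (Fin n) :=
    fun i => (SimpleGraph.cycleGraph i.1).map i.2
  have h := family_lower s y hy (by linarith) D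
  rw [graph_tot] at h
  have hup : ∑ G : SimpleGraph (Fin n), y ^ G.edgeSet.ncard * (∏ i ∈ s, if D i ≤ G then 0 else 1)
      ≤ ∑ F : SimpleGraph (Fin n) with F.IsAcyclic, y ^ F.edgeSet.ncard := by
    rw [Finset.sum_filter]
    apply Finset.sum_le_sum
    intro G _
    split_ifs with hG
    · apply mul_le_of_le_one_right (by positivity)
      apply Finset.prod_le_one
      · intro i _; split_ifs <;> norm_num
      · intro i _; split_ifs <;> norm_num
    · apply le_of_eq
      apply mul_eq_zero_of_right
      rw [SimpleGraph.isAcyclic_iff_free_cycleGraph] at hG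
      push Not at hG
      obtain ⟨k, hk, hc⟩ := hG
      obtain ⟨c⟩ := hc
      have hkn : k ≤ n := by
        simpa using Fintype.card_le_of_injective _ c.injective
      apply Finset.prod_eq_zero (i := ⟨k, ⟨c, c.injective⟩⟩)
      · simp [s, hk, hkn]
      · rw [if_pos]
        simp only [D]
        rw [SimpleGraph.map_le_iff_le_comap]
        intro u v huv
        exact c.toHom.map_adj huv
  refine le_trans (le_trans ?_ h) hup
  apply mul_le_mul_of_nonneg_right _ (by positivity)
  have h3 : Real.exp (∑ i ∈ s, -(2 * y ^ i.1)) ≤ ∏ i ∈ s, (1 - y ^ (D i).edgeSet.ncard) := by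
    rw [Real.exp_sum]
    apply Finset.prod_le_prod
    · intros; positivity
    · rintro ⟨k, c⟩ hi
      simp only [s, Finset.mem_sigma, Finset.mem_Icc] at hi
      simp only [D]
      rw [cycle_edges k hi.1.1 c]
      apply one_sub_ge_exp (by positivity)
      calc y ^ k ≤ y ^ 1 := pow_le_pow_of_le_one hy.le (by linarith) (by omega)
        _ ≤ 1/2 := by simpa using hy2
  refine le_trans (Real.exp_le_exp.2 ?_) h3
  rw [Finset.sum_neg_distrib, ← Finset.mul_sum, neg_le_neg_iff]
  apply mul_le_mul_of_nonneg_left _ (by norm_num)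
  rw [Finset.sum_sigma]
  calc ∑ k ∈ Finset.Icc 3 n, ∑ _c : (Fin k ↪ Fin n), y ^ k
      ≤ ∑ k ∈ Finset.Icc 3 n, (n * y) ^ k := by
        apply Finset.sum_le_sum
        intro k _
        rw [Finset.sum_const, nsmul_eq_mul, mul_pow]
        apply mul_le_mul_of_nonneg_right _ (by positivity)
        rw [Finset.card_univ, Fintype.card_embedding_eq]
        simp only [Fintype.card_fin]
        exact_mod_cast Nat.descFactorial_le_pow n k
    _ ≤ ∑' k : ℕ, (n * y) ^ k := by
        apply Summable.sum_le_tsum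
        · intros; positivity
        · exact summable_geometric_of_lt_one (by positivity) hny
    _ = _ := tsum_geometric_of_lt_one (by positivity) hny

lemma FG_true_eq (n : ℕ) (x : ℝ) (hx : 0 < x) : by
    classical exact FG (fun _ => True) n x =
      x ^ n * ∑ F : SimpleGraph (Fin n) with F.IsAcyclic, (1/x) ^ F.edgeSet.ncard := by
  classical
  unfold FG
  rw [Finset.mul_sum]
  apply Finset.sum_congr
  · ext F; simp [good]
  · intro F hF
    rw [Finset.mem_filter] at hF
    have h := forest_card hF.2
    rw [Nat.card_eq_fintype_card, Fintype.card_fin] at h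
    have h' : x ^ n = x ^ cc F * x ^ F.edgeSet.ncard := by rw [← pow_add, h]
    rw [h', mul_assoc, ← mul_pow, mul_one_div_cancel hx.ne', one_pow, mul_one]

lemma FG_upper (n : ℕ) (x : ℝ) (hx : 0 < x) :
    FG (fun _ => True) n x ≤ x ^ n * (1 + 1/x) ^ (n.choose 2) := by
  classical
  rw [FG_true_eq n x hx, ← graph_tot]
  apply mul_le_mul_of_nonneg_left _ (by positivity)
  apply Finset.sum_le_sum_of_subset_of_nonneg (Finset.filter_subset _ _)
  intros; positivity

lemma FG_lower (n : ℕ) (hn : 2 ≤ n) (x : ℝ) (hx : n < x) :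
    x ^ n * (Real.exp (-(2 * (1 - n / x)⁻¹)) * (1 + 1/x) ^ (n.choose 2)) ≤
      FG (fun _ => True) n x := by
  classical
  have hx0 : 0 < x := lt_of_le_of_lt (by positivity) hx
  rw [FG_true_eq n x hx0]
  apply mul_le_mul_of_nonneg_left _ (by positivity)
  have := forest_lower n hn (1/x) (by positivity) (by rw [mul_one_div, div_lt_one hx0]; exact hx)
  rwa [mul_one_div] at this

lemma sum_reach {V W : Type*} {F1 : SimpleGraph V} {F2 : SimpleGraph W} {a b : V ⊕ W}
    (h : (F1 ⊕g F2).Reachable a b) :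
    (∀ u v, a = Sum.inl u → b = Sum.inl v → F1.Reachable u v) ∧
    (∀ u v, a = Sum.inr u → b = Sum.inr v → F2.Reachable u v) := by
  obtain ⟨p⟩ := h
  induction p with
  | nil =>
    constructor
    · rintro u v rfl h; cases h; exact SimpleGraph.Reachable.refl _
    · rintro u v rfl h; cases h; exact SimpleGraph.Reachable.refl _
  | @cons a b c hadj p ih =>
    constructor
    · rintro u v rfl rfl
      rcases b with b | b
      · exact (SimpleGraph.Adj.reachable (by simpa using hadj)).trans (ih.1 b v rfl rfl)
      · simp at hadj
    · rintro u v rfl rfl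
      rcases b with b | b
      · simp at hadj
      · exact (SimpleGraph.Adj.reachable (by simpa using hadj)).trans (ih.2 b v rfl rfl)

lemma sum_reach_inl {V W : Type*} {F1 : SimpleGraph V} {F2 : SimpleGraph W} {u v : V} :
    (F1 ⊕g F2).Reachable (Sum.inl u) (Sum.inl v) ↔ F1.Reachable u v :=
  ⟨fun h => (sum_reach h).1 u v rfl rfl,
   fun h => h.map (SimpleGraph.Embedding.sumInl (G := F1) (H := F2)).toHom⟩

lemma sum_reach_inr {V W : Type*} {F1 : SimpleGraph V} {F2 : SimpleGraph W} {u v : W} :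
    (F1 ⊕g F2).Reachable (Sum.inr u) (Sum.inr v) ↔ F2.Reachable u v :=
  ⟨fun h => (sum_reach h).2 u v rfl rfl,
   fun h => h.map (SimpleGraph.Embedding.sumInr (G := F1) (H := F2)).toHom⟩

lemma sum_acyclic {V W : Type*} {F1 : SimpleGraph V} {F2 : SimpleGraph W}
    (h1 : F1.IsAcyclic) (h2 : F2.IsAcyclic) : (F1 ⊕g F2).IsAcyclic := by
  rw [SimpleGraph.isAcyclic_iff_forall_adj_isBridge] at *
  rintro (v | v) (w | w) h
  · have h' : F1.Adj v w := by simpa using h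
    have := h1 h'
    rw [SimpleGraph.isBridge_iff] at *
    intro hr
    apply this
    rw [← sum_reach_inl (F2 := F2)]
    refine hr.mono ?_
    rintro (a | a) (b | b) hab <;>
    simp_all [SimpleGraph.deleteEdges_adj]
  · simp at h
  · simp at h
  · have h' : F2.Adj v w := by simpa using h
    have := h2 h'
    rw [SimpleGraph.isBridge_iff] at *
    intro hr
    apply this
    rw [← sum_reach_inr (F1 := F1)]
    refine hr.mono ?_
    rintro (a | a) (b | b) hab <;>
    simp_all [SimpleGraph.deleteEdges_adj]

/-- Transport of the disjoint sum along an equivalence. -/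
def JG {V W X : Type*} (e : V ⊕ W ≃ X) (F1 : SimpleGraph V) (F2 : SimpleGraph W) :
    SimpleGraph X := (F1 ⊕g F2).comap e.symm

lemma JG_reach {V W X : Type*} (e : V ⊕ W ≃ X) (F1 : SimpleGraph V) (F2 : SimpleGraph W)
    (a b : V ⊕ W) : (JG e F1 F2).Reachable (e a) (e b) ↔ (F1 ⊕g F2).Reachable a b := by
  have := (SimpleGraph.Iso.comap e.symm (F1 ⊕g F2)).reachable_iff (u := e a) (v := e b)
  rw [JG, ← this]
  simp

lemma JG_acyclic {V W X : Type*} (e : V ⊕ W ≃ X) {F1 : SimpleGraph V} {F2 : SimpleGraph W}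
    (h1 : F1.IsAcyclic) (h2 : F2.IsAcyclic) : (JG e F1 F2).IsAcyclic :=
  (SimpleGraph.Iso.comap e.symm (F1 ⊕g F2)).isAcyclic_iff.2 (sum_acyclic h1 h2)

lemma JG_inj {V W X : Type*} (e : V ⊕ W ≃ X) {F1 F1' : SimpleGraph V} {F2 F2' : SimpleGraph W}
    (h : JG e F1 F2 = JG e F1' F2') : F1 = F1' ∧ F2 = F2' := by
  constructor
  · ext u v
    have : (JG e F1 F2).Adj (e (.inl u)) (e (.inl v)) ↔
      (JG e F1' F2').Adj (e (.inl u)) (e (.inl v)) := by rw [h]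
    simpa [JG] using this
  · ext u v
    have : (JG e F1 F2).Adj (e (.inr u)) (e (.inr v)) ↔
      (JG e F1' F2').Adj (e (.inr u)) (e (.inr v)) := by rw [h]
    simpa [JG] using this

lemma JG_good {n m N : ℕ} (e : Fin n ⊕ Fin m ≃ Fin N) (a : ℕ → Prop)
    {F1 : SimpleGraph (Fin n)} {F2 : SimpleGraph (Fin m)} (h1 : good a F1) (h2 : good a F2) :
    good a (JG e F1 F2) := by
  refine ⟨JG_acyclic e h1.1 h2.1, ?_⟩
  intro v
  obtain ⟨w, rfl⟩ := e.surjective v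
  rcases w with w | w
  · have : compSize (JG e F1 F2) (e (.inl w)) = compSize F1 w := by
      unfold compSize
      rw [← Set.ncard_image_of_injective (F1.connectedComponentMk w).supp
        (e.injective.comp Sum.inl_injective)]
      congr 1
      ext z
      obtain ⟨z, rfl⟩ := e.surjective z
      simp only [SimpleGraph.ConnectedComponent.mem_supp_iff, SimpleGraph.ConnectedComponent.eq,
        JG_reach, Set.mem_image, Function.comp, e.injective.eq_iff]
      rcases z with z | z
      · simp [sum_reach_inl]
      · simp only [reduceCtorEq, and_false, exists_false, iff_false]
        intro h
        exact SimpleGraph.not_reachable_sum_inl_inr _ _ h.symm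
    rw [this]; exact h1.2 w
  · have : compSize (JG e F1 F2) (e (.inr w)) = compSize F2 w := by
      unfold compSize
      rw [← Set.ncard_image_of_injective (F2.connectedComponentMk w).supp
        (e.injective.comp Sum.inr_injective)]
      congr 1
      ext z
      obtain ⟨z, rfl⟩ := e.surjective z
      simp only [SimpleGraph.ConnectedComponent.mem_supp_iff, SimpleGraph.ConnectedComponent.eq,
        JG_reach, Set.mem_image, Function.comp, e.injective.eq_iff]
      rcases z with z | z
      · simp only [reduceCtorEq, and_false, exists_false, iff_false]
        intro h
        exact SimpleGraph.not_reachable_sum_inl_inr _ _ h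
      · simp [sum_reach_inr]
    rw [this]; exact h2.2 w

lemma card_image_ker {α β γ : Type*} [DecidableEq β] [DecidableEq γ] (s : Finset α) (f : α → β)
    (g : α → γ) (h : ∀ x y, f x = f y ↔ g x = g y) : (s.image f).card = (s.image g).card := by
  classical
  refine Finset.card_bij (fun b hb => g (Finset.mem_image.1 hb).choose) ?_ ?_ ?_
  · intro b hb
    exact Finset.mem_image_of_mem _ (Finset.mem_image.1 hb).choose_spec.1
  · intro b hb b' hb' hh
    rw [← h, (Finset.mem_image.1 hb).choose_spec.2, (Finset.mem_image.1 hb').choose_spec.2] at hh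
    exact hh
  · intro c hc
    obtain ⟨x, hx, rfl⟩ := Finset.mem_image.1 hc
    refine ⟨f x, Finset.mem_image_of_mem _ hx, ?_⟩
    rw [← h]
    exact (Finset.mem_image.1 (Finset.mem_image_of_mem f hx)).choose_spec.2

open Classical in
/-- number of components meeting `A` -/
def cA {N : ℕ} (F : SimpleGraph (Fin N)) (A : Finset (Fin N)) : ℕ :=
  (A.image F.connectedComponentMk).card

open Classical in
lemma cA_univ {N : ℕ} (F : SimpleGraph (Fin N)) : cA F Finset.univ = cc F := by
  unfold cA cc
  rw [Finset.image_univ_of_surjective, Finset.card_univ, Nat.card_eq_fintype_card]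
  exact Quot.mk_surjective

/-- `A` is closed under adjacency. -/
def clo {N : ℕ} (F : SimpleGraph (Fin N)) (A : Finset (Fin N)) : Prop :=
  ∀ u ∈ A, ∀ v, F.Reachable u v → v ∈ A

open Classical in
lemma stepI {N : ℕ} (F : SimpleGraph (Fin N)) (x y : ℝ) (hx : 0 ≤ x) (hy : 0 ≤ y) :
    ∑ A : Finset (Fin N) with clo F A, x ^ cA F A * y ^ cA F Aᶜ ≤ (x + y) ^ cc F := by
  have hc : cc F = Fintype.card F.ConnectedComponent := by
    rw [cc, Nat.card_eq_fintype_card]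
  rw [hc, ← Fintype.sum_pow_mul_eq_add_pow]
  have key : ∀ A : Finset (Fin N), clo F A → ∀ v,
      F.connectedComponentMk v ∈ A.image F.connectedComponentMk ↔ v ∈ A := by
    intro A hA v
    constructor
    · intro h
      obtain ⟨u, hu, huv⟩ := Finset.mem_image.1 h
      exact hA u hu v (SimpleGraph.ConnectedComponent.eq.1 huv)
    · exact Finset.mem_image_of_mem _
  have e : ∀ A ∈ Finset.univ.filter (clo F), x ^ cA F A * y ^ cA F Aᶜ =
      x ^ (A.image F.connectedComponentMk).card *
        y ^ (Fintype.card F.ConnectedComponent - (A.image F.connectedComponentMk).card) := by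
    intro A hA
    rw [Finset.mem_filter] at hA
    rw [← Finset.card_compl, cA, cA]
    congr 3
    ext c
    obtain ⟨v, rfl⟩ := Quot.mk_surjective c
    change F.connectedComponentMk v ∈ _ ↔ F.connectedComponentMk v ∈ _
    rw [Finset.mem_compl, key A hA.2]
    constructor
    · intro h
      obtain ⟨u, hu, huv⟩ := Finset.mem_image.1 h
      intro hv
      rw [Finset.mem_compl] at hu
      exact hu (hA.2 v hv u (SimpleGraph.ConnectedComponent.eq.1 huv.symm))
    · intro h
      exact Finset.mem_image_of_mem _ (Finset.mem_compl.2 h)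
  rw [Finset.sum_congr rfl e, ← Finset.sum_image (s := Finset.univ.filter (clo F))
    (g := fun A : Finset (Fin N) => A.image F.connectedComponentMk)
    (f := fun S : Finset F.ConnectedComponent =>
      x ^ S.card * y ^ (Fintype.card F.ConnectedComponent - S.card))]
  · apply Finset.sum_le_sum_of_subset_of_nonneg (Finset.subset_univ _)
    intros; positivity
  · intro A hA B hB h
    rw [Finset.mem_coe, Finset.mem_filter] at hA hB
    ext v
    simp only at h
    rw [← key A hA.2, ← key B hB.2, h]

open Classical in
lemma stepII {n m : ℕ} (a : ℕ → Prop) (A : Finset (Fin (n+m))) (hA : A.card = n) (x y : ℝ)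
    (hx : 0 ≤ x) (hy : 0 ≤ y) :
    FG a n x * FG a m y ≤
      ∑ F : SimpleGraph (Fin (n+m)) with good a F ∧ clo F A, x ^ cA F A * y ^ cA F Aᶜ := by
  have hA' : Aᶜ.card = m := by rw [Finset.card_compl, Fintype.card_fin, hA]; omega
  let e : Fin n ⊕ Fin m ≃ Fin (n+m) := finSumEquivOfFinset hA hA'
  have hl : ∀ i, e (.inl i) ∈ A := by
    intro i
    simp [e]
  have hr : ∀ i, e (.inr i) ∈ Aᶜ := by
    intro i
    simp only [e, finSumEquivOfFinset_inr]
    exact Finset.orderEmbOfFin_mem _ _ _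
  have hAi : A = Finset.univ.image (fun i => e (.inl i)) := by
    symm
    apply Finset.eq_of_subset_of_card_le
    · intro z hz
      obtain ⟨i, _, rfl⟩ := Finset.mem_image.1 hz
      exact hl i
    · have hi : Function.Injective (fun i => e (Sum.inl i)) :=
        e.injective.comp Sum.inl_injective
      rw [Finset.card_image_of_injective _ hi]
      simp [hA]
  have hAi' : Aᶜ = Finset.univ.image (fun i => e (.inr i)) := by
    symm
    apply Finset.eq_of_subset_of_card_le
    · intro z hz
      obtain ⟨i, _, rfl⟩ := Finset.mem_image.1 hz
      exact hr i
    · have hi : Function.Injective (fun i => e (Sum.inr i)) :=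
        e.injective.comp Sum.inr_injective
      rw [Finset.card_image_of_injective _ hi]
      simp [hA']
  unfold FG
  rw [Finset.sum_mul_sum, ← Finset.sum_product']
  have key : ∀ P : SimpleGraph (Fin n) × SimpleGraph (Fin m),
      x ^ cc P.1 * y ^ cc P.2 = x ^ cA (JG e P.1 P.2) A * y ^ cA (JG e P.1 P.2) Aᶜ := by
    intro P
    congr 2
    · rw [← cA_univ, hAi, cA, cA, Finset.image_image]
      apply card_image_ker
      intro u v
      simp only [SimpleGraph.ConnectedComponent.eq, Function.comp, JG_reach, sum_reach_inl]
    · rw [← cA_univ, hAi', cA, cA, Finset.image_image]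
      apply card_image_ker
      intro u v
      simp only [SimpleGraph.ConnectedComponent.eq, Function.comp, JG_reach, sum_reach_inr]
  rw [Finset.sum_congr rfl (fun P _ => key P), ← Finset.sum_image
    (g := fun P : SimpleGraph (Fin n) × SimpleGraph (Fin m) => JG e P.1 P.2)
    (f := fun F => x ^ cA F A * y ^ cA F Aᶜ)]
  · apply Finset.sum_le_sum_of_subset_of_nonneg
    · intro F hF
      obtain ⟨P, hP, rfl⟩ := Finset.mem_image.1 hF
      rw [Finset.mem_product, Finset.mem_filter, Finset.mem_filter] at hP
      rw [Finset.mem_filter]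
      refine ⟨Finset.mem_univ _, JG_good e a hP.1.2 hP.2.2, ?_⟩
      intro u hu v huv
      rw [hAi] at hu
      obtain ⟨i, _, rfl⟩ := Finset.mem_image.1 hu
      obtain ⟨w, rfl⟩ := e.surjective v
      rw [JG_reach] at huv
      rcases w with w | w
      · exact hl w
      · exact absurd huv (SimpleGraph.not_reachable_sum_inl_inr _ _)
    · intros; positivity
  · rintro ⟨P1, P2⟩ _ ⟨Q1, Q2⟩ _ h
    obtain ⟨h1, h2⟩ := JG_inj e h
    exact Prod.ext h1 h2

lemma FG_super (a : ℕ → Prop) (n m : ℕ) (x y : ℝ) (hx : 0 ≤ x) (hy : 0 ≤ y) :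
    ((n+m).choose n : ℝ) * (FG a n x * FG a m y) ≤ FG a (n+m) (x+y) := by
  classical
  calc ((n+m).choose n : ℝ) * (FG a n x * FG a m y)
      = ∑ A ∈ Finset.powersetCard n (Finset.univ : Finset (Fin (n+m))), FG a n x * FG a m y := by
        rw [Finset.sum_const, Finset.card_powersetCard, nsmul_eq_mul, Finset.card_univ,
          Fintype.card_fin]
    _ ≤ ∑ A ∈ Finset.powersetCard n (Finset.univ : Finset (Fin (n+m))),
          ∑ F : SimpleGraph (Fin (n+m)) with good a F ∧ clo F A, x ^ cA F A * y ^ cA F Aᶜ := by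
        apply Finset.sum_le_sum
        intro A hA
        exact stepII a A (Finset.mem_powersetCard.1 hA).2 x y hx hy
    _ ≤ ∑ A : Finset (Fin (n+m)),
          ∑ F : SimpleGraph (Fin (n+m)) with good a F ∧ clo F A, x ^ cA F A * y ^ cA F Aᶜ := by
        apply Finset.sum_le_sum_of_subset_of_nonneg (Finset.subset_univ _)
        intros; positivity
    _ = ∑ F : SimpleGraph (Fin (n+m)) with good a F,
          ∑ A : Finset (Fin (n+m)) with clo F A, x ^ cA F A * y ^ cA F Aᶜ := by
        simp_rw [Finset.sum_filter]
        rw [Finset.sum_comm]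
        apply Finset.sum_congr rfl
        intro F _
        split_ifs with h <;> simp [h]
    _ ≤ FG a (n+m) (x+y) := by
        unfold FG
        apply Finset.sum_le_sum
        intro F _
        exact stepI F x y hx hy

lemma compSize_le {n : ℕ} (F : SimpleGraph (Fin n)) (v : Fin n) : compSize F v ≤ n := by
  unfold compSize
  calc _ ≤ (Set.univ : Set (Fin n)).ncard := Set.ncard_le_ncard (Set.subset_univ _)
    _ = n := by simp [Set.ncard_univ]

lemma cc_le {n : ℕ} (F : SimpleGraph (Fin n)) : cc F ≤ n := by
  classical
  rw [← cA_univ, cA]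
  refine Finset.card_image_le.trans ?_
  simp

lemma good_bot {n : ℕ} (a : ℕ → Prop) (ha : a 1) : good a (⊥ : SimpleGraph (Fin n)) := by
  refine ⟨SimpleGraph.isAcyclic_bot, fun v => ?_⟩
  have : compSize (⊥ : SimpleGraph (Fin n)) v = 1 := by
    unfold compSize
    rw [Set.ncard_eq_one]
    refine ⟨v, ?_⟩
    ext w
    simp [SimpleGraph.ConnectedComponent.mem_supp_iff]
  rwa [this]

lemma FG_pos (a : ℕ → Prop) (ha : a 1) (n : ℕ) (x : ℝ) (hx : 0 < x ∨ (n = 0 ∧ 0 ≤ x)) :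
    0 < FG a n x := by
  classical
  unfold FG
  have hx0 : 0 ≤ x := by rcases hx with h | h; exact h.le; exact h.2
  apply Finset.sum_pos'
  · intros; positivity
  · refine ⟨⊥, by simp [good_bot a ha], ?_⟩
    rcases hx with h | ⟨rfl, h⟩
    · positivity
    · have : cc (⊥ : SimpleGraph (Fin 0)) = 0 := Nat.le_zero.1 (cc_le _)
      rw [this]; simp

lemma FG_mono_a (a b : ℕ → Prop) (hab : ∀ k, a k → b k) (n : ℕ) (x : ℝ) (hx : 0 ≤ x) :
    FG a n x ≤ FG b n x := by
  classical
  unfold FG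
  apply Finset.sum_le_sum_of_subset_of_nonneg
  · intro F hF
    rw [Finset.mem_filter] at *
    exact ⟨hF.1, hF.2.1, fun v => hab _ (hF.2.2 v)⟩
  · intros; positivity

lemma FG_large (n r : ℕ) (h : n ≤ r) (x : ℝ) :
    FG (fun k => k ≤ r) n x = FG (fun _ => True) n x := by
  classical
  unfold FG
  apply Finset.sum_congr _ (fun _ _ => rfl)
  ext F
  rw [Finset.mem_filter, Finset.mem_filter]
  refine and_congr_right fun _ => and_congr_right fun _ => ⟨fun _ _ => trivial, fun _ v => (compSize_le F v).trans h⟩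

lemma FG_mono (a : ℕ → Prop) (n : ℕ) (x y : ℝ) (hx : 0 ≤ x) (hxy : x ≤ y) :
    FG a n x ≤ FG a n y := by
  classical
  unfold FG
  exact Finset.sum_le_sum fun F _ => pow_le_pow_left₀ hx hxy _

lemma FG_lip (a : ℕ → Prop) (n : ℕ) (x y : ℝ) (hx : 0 < x) (hxy : x ≤ y) :
    FG a n y ≤ (y / x) ^ n * FG a n x := by
  classical
  unfold FG
  rw [Finset.mul_sum]
  refine Finset.sum_le_sum fun F _ => ?_
  have h1 : 1 ≤ y / x := (one_le_div hx).2 hxy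
  calc y ^ cc F = (y / x) ^ cc F * x ^ cc F := by rw [← mul_pow, div_mul_cancel₀ _ hx.ne']
    _ ≤ _ := mul_le_mul_of_nonneg_right (pow_le_pow_right₀ h1 (cc_le F)) (by positivity)

/-- normalised log generating function -/
def LF (a : ℕ → Prop) (n : ℕ) (x : ℝ) : ℝ := Real.log (FG a n x / n.factorial)

lemma pos_cond {n : ℕ} {s : ℝ} (hs : 0 < s) : 0 < (n:ℝ) * s ∨ (n = 0 ∧ 0 ≤ (n:ℝ) * s) := by
  rcases Nat.eq_zero_or_pos n with h | h
  · right; exact ⟨h, by positivity⟩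
  · left; positivity

lemma LF_super (a : ℕ → Prop) (ha : a 1) (n m : ℕ) (s t : ℝ) (hs : 0 < s) (ht : 0 < t) :
    LF a n (n * s) + LF a m (m * t) ≤ LF a (n+m) (n * s + m * t) := by
  have h1 := FG_pos a ha n _ (pos_cond hs)
  have h2 := FG_pos a ha m _ (pos_cond ht)
  have f1 : (0:ℝ) < n.factorial := by exact_mod_cast n.factorial_pos
  have f2 : (0:ℝ) < m.factorial := by exact_mod_cast m.factorial_pos
  have f3 : (0:ℝ) < (n+m).factorial := by exact_mod_cast (n+m).factorial_pos
  unfold LF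
  rw [← Real.log_mul (by positivity) (by positivity)]
  apply Real.log_le_log (by positivity)
  have := FG_super a n m (n*s) (m*t) (by positivity) (by positivity)
  have hc : ((n+m).choose n : ℝ) * n.factorial * m.factorial = (n+m).factorial := by
    have := Nat.add_choose_mul_factorial_mul_factorial n m
    rw [← Nat.choose_symm_add] at this
    exact_mod_cast this
  rw [le_div_iff₀ f3, ← hc]
  refine le_trans (le_of_eq ?_) this
  field_simp

lemma LF_bound (a : ℕ → Prop) (ha : a 1) (n : ℕ) (s : ℝ) (hs : 0 < s) (hn : 1 ≤ n) :
    LF a n (n * s) ≤ n * (Real.log s + 1 + 1 / (2 * s)) := by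
  have hn' : (0:ℝ) < n := by exact_mod_cast hn
  have h1 := FG_pos a ha n _ (pos_cond hs)
  have f1 : (0:ℝ) < n.factorial := by exact_mod_cast n.factorial_pos
  have hx : 0 < n * s := by positivity
  have h2 := (FG_mono_a a (fun _ => True) (fun _ _ => trivial) n _ hx.le).trans (FG_upper n _ hx)
  unfold LF
  rw [Real.log_le_iff_le_exp (by positivity), div_le_iff₀ f1]
  refine h2.trans ?_
  have h3 : (1 + 1/(n*s)) ^ (n.choose 2) ≤ Real.exp (n * (1 / (2*s))) := by
    calc (1 + 1/(n*s)) ^ (n.choose 2) ≤ (Real.exp (1/(n*s))) ^ (n.choose 2) := by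
          apply pow_le_pow_left₀ (by positivity)
          rw [add_comm]; exact Real.add_one_le_exp _
      _ = Real.exp (n.choose 2 * (1/(n*s))) := by rw [← Real.exp_nat_mul]
      _ ≤ _ := by
          apply Real.exp_le_exp.2
          rw [Nat.cast_choose_two]
          field_simp
          linarith
  have h4 : (n:ℝ)^n ≤ Real.exp n * n.factorial := by
    rw [← div_le_iff₀ f1]
    exact Real.pow_div_factorial_le_exp _ hn'.le n
  have h5 : s ^ n = Real.exp (n * Real.log s) := by
    rw [Real.exp_nat_mul, Real.exp_log hs]
  calc (n * s)^n * (1 + 1/(n*s)) ^ (n.choose 2) ≤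
        ((Real.exp n * n.factorial) * Real.exp (n * Real.log s)) * Real.exp (n * (1 / (2*s))) := by
          rw [mul_pow, ← h5]
          gcongr
    _ = _ := by
      rw [mul_add, mul_add, Real.exp_add, Real.exp_add, mul_one]
      ring

lemma LF_mono (a : ℕ → Prop) (ha : a 1) (n : ℕ) (s t : ℝ) (hs : 0 < s) (hst : s ≤ t) :
    LF a n (n * s) ≤ LF a n (n * t) := by
  have h1 := FG_pos a ha n _ (pos_cond hs)
  unfold LF
  have f1 : (0:ℝ) < n.factorial := by exact_mod_cast n.factorial_pos
  apply Real.log_le_log (by positivity)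
  gcongr
  exact FG_mono a n _ _ (by positivity) (by gcongr)

lemma LF_lip (a : ℕ → Prop) (ha : a 1) (n : ℕ) (s t : ℝ) (hs : 0 < s) (hst : s ≤ t) :
    LF a n (n * t) ≤ LF a n (n * s) + n * (Real.log t - Real.log s) := by
  have ht : 0 < t := hs.trans_le hst
  rcases Nat.eq_zero_or_pos n with rfl | hn
  · simp
  have h1 := FG_pos a ha n _ (pos_cond hs)
  have h2 := FG_pos a ha n _ (pos_cond ht)
  have f1 : (0:ℝ) < n.factorial := by exact_mod_cast n.factorial_pos
  have hn' : (0:ℝ) < n := by exact_mod_cast hn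
  unfold LF
  rw [← Real.log_div ht.ne' hs.ne', ← Real.log_pow, ← Real.log_mul (by positivity) (by positivity)]
  apply Real.log_le_log (by positivity)
  have := FG_lip a n (n*s) (n*t) (by positivity) (by gcongr)
  rw [mul_div_mul_left _ _ hn'.ne'] at this
  rw [div_mul_eq_mul_div, mul_comm (FG _ _ _)]
  gcongr

/-- limiting free energy -/
def hl (a : ℕ → Prop) (s : ℝ) : ℝ := limUnder atTop (fun n : ℕ => LF a n (n * s) / n)

lemma LF_sub (a : ℕ → Prop) (ha : a 1) (s : ℝ) (hs : 0 < s) :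
    Subadditive (fun n => - LF a n (n * s)) := by
  intro m n
  have := LF_super a ha m n s s hs hs
  rw [← add_mul, ← Nat.cast_add] at this
  linarith

lemma LF_bdd (a : ℕ → Prop) (ha : a 1) (s : ℝ) (hs : 0 < s) :
    BddBelow (Set.range fun n : ℕ => (- LF a n (n * s)) / n) := by
  refine ⟨min 0 (-(Real.log s + 1 + 1 / (2 * s))), ?_⟩
  rintro _ ⟨n, rfl⟩
  rcases Nat.eq_zero_or_pos n with rfl | hn
  · simp
  have hn' : (0:ℝ) < n := by exact_mod_cast hn
  apply (min_le_right _ _).trans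
  simp only
  rw [le_div_iff₀ hn']
  have := LF_bound a ha n s hs hn
  linarith

lemma hl_aux (a : ℕ → Prop) (ha : a 1) (s : ℝ) (hs : 0 < s) :
    Tendsto (fun n : ℕ => LF a n (n * s) / n) atTop (𝓝 (-(LF_sub a ha s hs).lim)) := by
  have := ((LF_sub a ha s hs).tendsto_lim (LF_bdd a ha s hs)).neg
  refine this.congr fun n => ?_
  ring

lemma hl_tendsto (a : ℕ → Prop) (ha : a 1) (s : ℝ) (hs : 0 < s) :
    Tendsto (fun n : ℕ => LF a n (n * s) / n) atTop (𝓝 (hl a s)) :=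
  tendsto_nhds_limUnder ⟨_, hl_aux a ha s hs⟩

lemma hl_ge (a : ℕ → Prop) (ha : a 1) (s : ℝ) (hs : 0 < s) (n : ℕ) (hn : 1 ≤ n) :
    LF a n (n * s) / n ≤ hl a s := by
  have e := tendsto_nhds_unique (hl_tendsto a ha s hs) (hl_aux a ha s hs)
  have := (LF_sub a ha s hs).lim_le_div (LF_bdd a ha s hs) (n := n) (by omega)
  rw [e]
  rw [neg_div] at this
  linarith

lemma hl_le (a : ℕ → Prop) (ha : a 1) (s : ℝ) (hs : 0 < s) :
    hl a s ≤ Real.log s + 1 + 1 / (2 * s) := by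
  apply le_of_tendsto (hl_tendsto a ha s hs)
  filter_upwards [eventually_ge_atTop 1] with n hn
  have hn' : (0:ℝ) < n := by exact_mod_cast hn
  rw [div_le_iff₀ hn']
  exact (LF_bound a ha n s hs hn).trans (le_of_eq (mul_comm _ _))

lemma hl_mono_a (a b : ℕ → Prop) (ha : a 1) (hab : ∀ k, a k → b k) (s : ℝ) (hs : 0 < s) :
    hl a s ≤ hl b s := by
  apply le_of_tendsto_of_tendsto' (hl_tendsto a ha s hs) (hl_tendsto b (hab _ ha) s hs)
  intro n
  apply div_le_div_of_nonneg_right _ (by positivity)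
  have h1 := FG_pos a ha n _ (pos_cond hs)
  have f1 : (0:ℝ) < n.factorial := by exact_mod_cast n.factorial_pos
  unfold LF
  apply Real.log_le_log (by positivity)
  gcongr
  exact FG_mono_a a b hab n _ (by positivity)

lemma hl_lip (a : ℕ → Prop) (ha : a 1) (s t : ℝ) (hs : 0 < s) (hst : s ≤ t) :
    hl a t ≤ hl a s + (Real.log t - Real.log s) := by
  have ht : 0 < t := hs.trans_le hst
  apply le_of_tendsto_of_tendsto (hl_tendsto a ha t ht) ((hl_tendsto a ha s hs).add_const _)
  filter_upwards [eventually_ge_atTop 1] with n hn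
  have hn' : (0:ℝ) < n := by exact_mod_cast hn
  have := LF_lip a ha n s t hs hst
  rw [div_add' _ _ _ hn'.ne']
  gcongr
  linarith

lemma hl_conc (a : ℕ → Prop) (ha : a 1) (A B : ℕ) (hA : 1 ≤ A) (hB : 1 ≤ B) (s t : ℝ)
    (hs : 0 < s) (ht : 0 < t) :
    A * hl a s + B * hl a t ≤ (A + B) * hl a ((A * s + B * t) / (A + B)) := by
  have hA' : (0:ℝ) < A := by exact_mod_cast hA
  have hB' : (0:ℝ) < B := by exact_mod_cast hB
  have tt : ∀ C : ℕ, 1 ≤ C → Tendsto (fun n : ℕ => C * n) atTop atTop := fun C hC =>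
    tendsto_id.const_mul_atTop' (by omega)
  have h1 := ((hl_tendsto a ha s hs).comp (tt A hA)).const_mul (A:ℝ)
  have h2 := ((hl_tendsto a ha t ht).comp (tt B hB)).const_mul (B:ℝ)
  have h3 := ((hl_tendsto a ha ((A * s + B * t) / (A + B)) (by positivity)).comp
    (tt (A+B) (by omega))).const_mul ((A:ℝ) + B)
  apply le_of_tendsto_of_tendsto (h1.add h2) h3
  filter_upwards [eventually_ge_atTop 1] with n hn
  have hn' : (0:ℝ) < n := by exact_mod_cast hn
  have := LF_super a ha (A*n) (B*n) s t hs ht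
  have e : (((A*n : ℕ):ℝ) * s + ((B*n : ℕ):ℝ) * t) =
    (((A+B)*n : ℕ):ℝ) * ((A * s + B * t) / (A + B)) := by
    push_cast
    field_simp
  rw [e, ← add_mul] at this
  simp only [Function.comp]
  generalize LF a (A*n) _ = X at *
  generalize LF a (B*n) _ = Y at *
  generalize LF a ((A+B)*n) _ = Z at *
  push_cast
  have e1 : (A:ℝ) * (X / (A * n)) = X / n := by field_simp
  have e2 : (B:ℝ) * (Y / (B * n)) = Y / n := by field_simp
  have e3 : ((A:ℝ)+B) * (Z / ((A+B) * n)) = Z / n := by field_simp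
  rw [e1, e2, e3, ← add_div]
  gcongr

lemma stirling_lim :
    Tendsto (fun n : ℕ => Real.log n - Real.log (n.factorial) / n) atTop (𝓝 1) := by
  have h1 : Tendsto (fun n : ℕ => Real.log (Stirling.stirlingSeq n)) atTop
      (𝓝 (Real.log (√Real.pi))) := by
    apply Stirling.tendsto_stirlingSeq_sqrt_pi.log
    positivity
  have h2 : Tendsto (fun n : ℕ => (1:ℝ) / n) atTop (𝓝 0) := tendsto_one_div_atTop_nhds_zero_nat
  have h3 : Tendsto (fun n : ℕ => Real.log n / n) atTop (𝓝 0) := by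
    have := (Real.isLittleO_log_id_atTop.tendsto_div_nhds_zero).comp tendsto_natCast_atTop_atTop
    exact this
  have h4 := (((h1.mul h2).add ((h2.const_mul (Real.log 2 / 2)).add (h3.const_mul (1/2)))).const_sub 1)
  have e : (1:ℝ) - (Real.log (√Real.pi) * 0 + (Real.log 2 / 2 * 0 + 1/2 * 0)) = 1 := by ring
  rw [e] at h4
  refine h4.congr' ?_
  filter_upwards [eventually_ge_atTop 1] with n hn
  have hn' : (0:ℝ) < n := by exact_mod_cast hn
  rw [Stirling.log_stirlingSeq_formula, Real.log_mul (by norm_num) hn'.ne',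
    Real.log_div hn'.ne' (Real.exp_pos 1).ne', Real.log_exp]
  field_simp
  ring

lemma hl_big_ge (s : ℝ) (hs : 1 < s) :
    Real.log s + 1 + 1 / (2 * s) ≤ hl (fun _ => True) s := by
  have hs0 : 0 < s := by linarith
  set c : ℝ := 2 * (1 - 1/s)⁻¹ with hc
  have h2 : Tendsto (fun n : ℕ => (1:ℝ) / n) atTop (𝓝 0) := tendsto_one_div_atTop_nhds_zero_nat
  have h3 : Tendsto (fun n : ℕ => (1 - (1:ℝ) / n) / (2 * (s + 1/n))) atTop (𝓝 ((1-0)/(2*(s+0)))) := by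
    apply (h2.const_sub 1).div ((h2.const_add s).const_mul 2)
    positivity
  have h4 := ((stirling_lim.const_add (Real.log s)).add h3).sub (h2.const_mul c)
  simp only [sub_zero, add_zero, mul_zero] at h4
  apply le_of_tendsto_of_tendsto h4 (hl_tendsto _ trivial s hs0)
  filter_upwards [eventually_ge_atTop 2] with n hn
  have hn' : (0:ℝ) < n := by positivity
  have f1 : (0:ℝ) < n.factorial := by exact_mod_cast n.factorial_pos
  have hx : 0 < n * s := by positivity
  have hl := FG_lower n hn (n*s) (by nlinarith)
  have e1 : (n:ℝ) / (n * s) = 1/s := by field_simp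
  rw [e1, ← hc] at hl
  have hpos : 0 < (n*s)^n * (Real.exp (-c) * (1 + 1/(n*s))^(n.choose 2)) := by positivity
  have hlog := Real.log_le_log hpos hl
  rw [Real.log_mul (by positivity) (by positivity), Real.log_mul (by positivity) (by positivity),
    Real.log_exp, Real.log_pow, Real.log_pow, Real.log_mul hn'.ne' hs0.ne', Nat.cast_choose_two] at hlog
  have ht : 1 / (n * s + 1) ≤ Real.log (1 + 1/(n*s)) := by
    refine le_trans (le_of_eq ?_) (Real.one_sub_inv_le_log_of_pos (by positivity))
    field_simp
    ring
  have hge : (0:ℝ) ≤ n * (n-1)/2 := by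
    have : (1:ℝ) ≤ n := by exact_mod_cast (by omega : 1 ≤ n)
    have : (0:ℝ) ≤ n - 1 := by linarith
    positivity
  have hm := mul_le_mul_of_nonneg_left ht hge
  unfold LF
  have hF := FG_pos (fun _ => True) trivial n (n*s) (Or.inl hx)
  rw [Real.log_div hF.ne' f1.ne', le_div_iff₀ hn']
  have e2 : (Real.log s + (Real.log n - Real.log n.factorial / n) + (1 - 1/n) / (2 * (s + 1/n)) - c * (1/n)) * n
    = n * (Real.log n + Real.log s) + (-c + n * (n-1)/2 * (1/(n*s+1))) - Real.log n.factorial := by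
    field_simp
    ring
  rw [e2]
  linarith

lemma hl_big (s : ℝ) (hs : 1 < s) : hl (fun _ => True) s = Real.log s + 1 + 1 / (2 * s) :=
  le_antisymm (hl_le _ trivial s (by linarith)) (hl_big_ge s hs)

lemma hl_one : hl (fun _ => True) 1 = 3/2 := by
  apply le_antisymm
  · have := hl_le (fun _ => True) trivial 1 one_pos
    norm_num at this
    linarith
  · have h : Tendsto (fun s : ℝ => 1 + 1/(2*s)) (𝓝[>] 1) (𝓝 (1 + 1/(2*1))) := by
      apply tendsto_nhdsWithin_of_tendsto_nhds
      apply ContinuousAt.tendsto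
      fun_prop (disch := norm_num)
    have e : (1:ℝ) + 1/(2*1) = 3/2 := by norm_num
    rw [e] at h
    apply le_of_tendsto h
    filter_upwards [self_mem_nhdsWithin] with s hs
    have hs : 1 < s := hs
    have h1 := hl_lip (fun _ => True) trivial 1 s one_pos hs.le
    rw [hl_big s hs, Real.log_one] at h1
    linarith

lemma hl_ge_one (s : ℝ) (hs : 0 < s) : 1 ≤ hl (fun _ => True) s := by
  have h2 : Tendsto (fun n : ℕ => (1:ℝ) / n) atTop (𝓝 0) := tendsto_one_div_atTop_nhds_zero_nat
  have h3 : Tendsto (fun n : ℕ => Real.log n / n) atTop (𝓝 0) := by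
    have := (Real.isLittleO_log_id_atTop.tendsto_div_nhds_zero).comp tendsto_natCast_atTop_atTop
    exact this
  have h4 := (stirling_lim.sub h3).add (h2.const_mul (Real.log s))
  simp only [sub_zero, add_zero, mul_zero] at h4
  apply le_of_tendsto_of_tendsto h4 (hl_tendsto _ trivial s hs)
  filter_upwards [eventually_ge_atTop 2] with n hn
  have hn' : (0:ℝ) < n := by positivity
  have f1 : (0:ℝ) < n.factorial := by exact_mod_cast n.factorial_pos
  have hx : 0 < n * s := by positivity
  have hF := FG_pos (fun _ => True) trivial n (n*s) (Or.inl hx)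
  have ht := tree_lower n (by omega) (n*s) hx.le
  have ht' : (n:ℝ)^(n-1) * s ≤ FG (fun _ => True) n (n*s) := by
    apply le_of_mul_le_mul_left _ hn'
    linarith
  have hlog := Real.log_le_log (by positivity) ht'
  rw [Real.log_mul (by positivity) (by positivity), Real.log_pow, Nat.cast_sub (by omega)] at hlog
  unfold LF
  rw [Real.log_div hF.ne' f1.ne', le_div_iff₀ hn']
  refine le_trans (le_of_eq ?_) (sub_le_sub_right hlog _)
  push_cast
  field_simp
  ring

lemma hl_small_le (s : ℝ) (hs : 0 < s) (hs1 : s < 1) : hl (fun _ => True) s ≤ 1 + s/2 := by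
  have h2 : Tendsto (fun n : ℕ => (1:ℝ) / n) atTop (𝓝 0) := tendsto_one_div_atTop_nhds_zero_nat
  have h3 : Tendsto (fun b : ℕ => 3/2 - (1-s) / (2 * (1 + (1-s) * (1/b)))) atTop
      (𝓝 (3/2 - (1-s)/(2 * (1 + (1-s)*0)))) := by
    apply Tendsto.const_sub
    apply tendsto_const_nhds.div (((h2.const_mul (1-s)).const_add 1).const_mul 2)
    norm_num
  have e : 3/2 - (1-s)/(2 * (1 + (1-s)*0)) = 1 + s/2 := by ring
  rw [e] at h3
  apply ge_of_tendsto h3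
  filter_upwards [eventually_ge_atTop 1] with b hb
  have hb' : (0:ℝ) < b := by exact_mod_cast hb
  have hd : 0 < 1 - s := by linarith
  set t := (1-s)/b with ht
  have ht0 : 0 < t := by positivity
  have hc := hl_conc (fun _ => True) trivial 1 b le_rfl hb s (1 + t) hs (by positivity)
  have e1 : (((1:ℕ):ℝ) * s + b * (1+t)) / ((1:ℕ) + b) = 1 := by
    rw [ht]; field_simp; push_cast; ring
  rw [e1, hl_one, hl_big (1+t) (by linarith)] at hc
  have hlog : 1 - (1+t)⁻¹ ≤ Real.log (1+t) := Real.one_sub_inv_le_log_of_pos (by positivity)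
  have hm := mul_le_mul_of_nonneg_left hlog hb'.le
  have e2 : (b:ℝ) * (1 - (1+t)⁻¹) - b/2 + b * (1/(2*(1+t))) = (1-s)/(2*(1+(1-s)*(1/b))) := by
    have : (1-s) = b * t := by rw [ht]; field_simp
    rw [this]; field_simp; ring
  push_cast at hc
  linarith

lemma hl_small_ge (s : ℝ) (hs : 0 < s) (hs1 : s < 1) : 1 + s/2 ≤ hl (fun _ => True) s := by
  by_contra hcon
  push Not at hcon
  obtain ⟨r, hr1, hr2⟩ := exists_rat_btwn (show max 0 (2 * (hl (fun _ => True) s - 1)) < s by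
    rw [max_lt_iff]; constructor <;> linarith)
  rw [max_lt_iff] at hr1
  have hr0 : 0 < r := by exact_mod_cast hr1.1
  have hr3 : r < 1 := by exact_mod_cast hr2.trans hs1
  obtain ⟨B, hB⟩ : ∃ B : ℕ, r.num = B := ⟨r.num.toNat, by
    have := Rat.num_pos.2 hr0; omega⟩
  have hBpos : 1 ≤ B := by have := Rat.num_pos.2 hr0; omega
  have hlt : B < r.den := by
    have h := hr3
    rw [Rat.lt_iff] at h
    simp only [Rat.den_one, Rat.num_one] at h
    push_cast at h
    omega
  obtain ⟨A, hA⟩ : ∃ A, r.den = A + B := ⟨r.den - B, by omega⟩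
  have hApos : 1 ≤ A := by omega
  have hA' : (0:ℝ) < A := by exact_mod_cast hApos
  have hB' : (0:ℝ) < B := by exact_mod_cast hBpos
  have hre : (r:ℝ) = B / (A + B) := by
    rw [Rat.cast_def, hB, hA]; push_cast; rfl
  rw [hre] at hr2 hr1
  rw [div_lt_iff₀ (by positivity)] at hr2
  have hc := hl_conc (fun _ => True) trivial A B hApos hBpos ((s * (A+B) - B)/A) 1
    (by apply div_pos _ hA'; linarith) one_pos
  have e1 : ((A:ℝ) * ((s * (A+B) - B)/A) + B * 1) / (A + B) = s := by field_simp; ring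
  rw [e1, hl_one] at hc
  have h1 := hl_ge_one ((s * (A+B) - B)/A) (by apply div_pos _ hA'; linarith)
  have h2 := hr1.2
  rw [lt_div_iff₀ (by positivity)] at h2
  nlinarith [mul_le_mul_of_nonneg_left h1 hA'.le]

lemma hl_small (s : ℝ) (hs : 0 < s) (hs1 : s < 1) : hl (fun _ => True) s = 1 + s/2 :=
  le_antisymm (hl_small_le s hs hs1) (hl_small_ge s hs hs1)

lemma Zrc_eq (a : ℕ → Prop) (n : ℕ) (lam q : ℝ) (hl0 : 0 < lam) (hn : lam < n) :
    Zrc n lam q {F | good a F} = (1 - lam/n) ^ (n.choose 2) * ((lam/n) / (1 - lam/n)) ^ n *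
      FG a n (n * (q * (1 - lam/n) / lam)) := by
  classical
  have hn0 : (0:ℝ) < n := hl0.trans hn
  set p := lam / n with hp
  have hp0 : 0 < p := by positivity
  have hp1 : 0 < 1 - p := by
    have : p < 1 := (div_lt_one hn0).2 hn
    linarith
  have hlam : lam = n * p := by rw [hp]; field_simp
  unfold Zrc ZP FG
  rw [finsum_mem_eq_finite_toFinset_sum _ (Set.toFinite _), Finset.mul_sum]
  apply Finset.sum_congr
  · ext F; simp
  · intro F hF
    have hF : good a F := by simpa using hF
    have hc := forest_card hF.1
    rw [Nat.card_eq_fintype_card, Fintype.card_fin] at hc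
    have he : F.edgeSet.ncard ≤ n.choose 2 := by
      rw [← SimpleGraph.coe_edgeFinset, Set.ncard_coe_finset]
      simpa using SimpleGraph.card_edgeFinset_le_card_choose_two (G := F)
    unfold rcW
    rw [← hp, ← Nat.choose_two_right]
    change _ * _ * q ^ cc F = _
    obtain ⟨M, hM⟩ := Nat.exists_eq_add_of_le he
    have e1 : (p / (1 - p)) ^ n = (p/(1-p)) ^ cc F * (p/(1-p)) ^ F.edgeSet.ncard := by
      rw [← pow_add, hc]
    have e2 : n * (q * (1 - p) / lam) = q * ((1 - p) / p) := by
      rw [hlam]; field_simp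
    rw [e1, e2, hM, Nat.add_sub_cancel_left, mul_pow, pow_add]
    have e3 : ((1-p)/p) ^ cc F * (p/(1-p)) ^ cc F = 1 := by
      rw [← mul_pow]
      have : (1-p)/p * (p/(1-p)) = 1 := by field_simp
      rw [this, one_pow]
    have e4 : (1-p) ^ F.edgeSet.ncard * (p/(1-p)) ^ F.edgeSet.ncard = p ^ F.edgeSet.ncard := by
      rw [← mul_pow]
      congr 1
      field_simp
    calc p ^ F.edgeSet.ncard * (1-p)^M * q ^ cc F
        = ((1-p) ^ F.edgeSet.ncard * (p/(1-p)) ^ F.edgeSet.ncard) * (1-p)^M * q ^ cc F *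
          (((1-p)/p) ^ cc F * (p/(1-p)) ^ cc F) := by rw [e3, e4, mul_one]
      _ = _ := by ring

lemma logZ_eq (a : ℕ → Prop) (ha : a 1) (n : ℕ) (lam q : ℝ) (hq : 0 < q) (hl0 : 0 < lam)
    (hn : lam < n) :
    (1/(n:ℝ)) * Real.log (Zrc n lam q {F | good a F}) =
      ((n:ℝ) - 3)/2 * Real.log (1 - lam/n) + Real.log lam
        - (Real.log n - Real.log n.factorial / n) + LF a n (n * (q * (1 - lam/n) / lam)) / n := by
  have hn0 : (0:ℝ) < n := hl0.trans hn
  have hp1 : 0 < 1 - lam/n := by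
    have : lam/n < 1 := (div_lt_one hn0).2 hn
    linarith
  have f1 : (0:ℝ) < n.factorial := by exact_mod_cast n.factorial_pos
  have hF := FG_pos a ha n (n * (q * (1 - lam/n) / lam)) (Or.inl (by positivity))
  rw [Zrc_eq a n lam q hl0 hn, Real.log_mul (by positivity) hF.ne',
    Real.log_mul (by positivity) (by positivity), Real.log_pow, Real.log_pow,
    Real.log_div (by positivity) hp1.ne', Real.log_div hl0.ne' hn0.ne', LF,
    Real.log_div hF.ne' f1.ne', Nat.cast_choose_two]
  generalize Real.log (FG _ _ _) = X
  field_simp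
  ring

lemma LF_dist (a : ℕ → Prop) (ha : a 1) (n : ℕ) (hn : 1 ≤ n) (s t : ℝ) (hs : 0 < s) (ht : 0 < t) :
    |LF a n (n * s) / n - LF a n (n * t) / n| ≤ |Real.log s - Real.log t| := by
  have hn' : (0:ℝ) < n := by exact_mod_cast hn
  rw [← sub_div, abs_div, abs_of_pos hn', div_le_iff₀ hn']
  wlog h : s ≤ t generalizing s t
  · have := this t s ht hs (by linarith)
    rwa [abs_sub_comm, abs_sub_comm (Real.log s)]
  · have h1 := LF_mono a ha n s t hs h
    have h2 := LF_lip a ha n s t hs h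
    have h3 := Real.log_le_log hs h
    rw [abs_of_nonpos (by linarith), abs_of_nonpos (by linarith)]
    linarith

lemma joint (a : ℕ → Prop) (ha : a 1) (q : ℝ) (hq : 0 < q) (l0 : ℝ) (hl0 : 0 < l0) :
    Tendsto (fun y : ℕ × ℝ => (1/(y.1:ℝ)) * Real.log (Zrc y.1 y.2 q {F | good a F}))
      (atTop ×ˢ 𝓝 l0) (𝓝 (-l0/2 + Real.log l0 - 1 + hl a (q/l0))) := by
  have tn : Tendsto (fun y : ℕ × ℝ => y.1) (atTop ×ˢ 𝓝 l0) atTop := tendsto_fst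
  have tl : Tendsto (fun y : ℕ × ℝ => y.2) (atTop ×ˢ 𝓝 l0) (𝓝 l0) := tendsto_snd
  have ti : Tendsto (fun y : ℕ × ℝ => (1:ℝ)/y.1) (atTop ×ˢ 𝓝 l0) (𝓝 0) :=
    tendsto_one_div_atTop_nhds_zero_nat.comp tn
  have tp : Tendsto (fun y : ℕ × ℝ => y.2/y.1) (atTop ×ˢ 𝓝 l0) (𝓝 0) := by
    have := tl.mul ti
    rw [mul_zero] at this
    refine this.congr fun y => by ring
  have ev1 : ∀ᶠ y : ℕ × ℝ in atTop ×ˢ 𝓝 l0, 3 ≤ y.1 := tn.eventually_ge_atTop 3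
  have ev2 : ∀ᶠ y : ℕ × ℝ in atTop ×ˢ 𝓝 l0, 0 < y.2 := tl.eventually_const_lt hl0
  have ev3 : ∀ᶠ y : ℕ × ℝ in atTop ×ˢ 𝓝 l0, y.2/y.1 < 1 := tp.eventually_lt_const one_pos
  -- first term
  have T1 : Tendsto (fun y : ℕ × ℝ => ((y.1:ℝ) - 3)/2 * Real.log (1 - y.2/y.1))
      (atTop ×ˢ 𝓝 l0) (𝓝 (-l0/2)) := by
    have A : Tendsto (fun y : ℕ × ℝ => -((1/2) * (1 - 3 * (1/(y.1:ℝ))) * y.2))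
        (atTop ×ˢ 𝓝 l0) (𝓝 (-l0/2)) := by
      have := ((((ti.const_mul 3).const_sub 1).const_mul (1/2)).mul tl).neg
      convert this using 2
      ring
    have B : Tendsto (fun y : ℕ × ℝ => -((1/2) * (1 - 3 * (1/(y.1:ℝ))) * y.2) / (1 - y.2/y.1))
        (atTop ×ˢ 𝓝 l0) (𝓝 (-l0/2)) := by
      have := A.div (tp.const_sub 1) (by norm_num)
      rw [sub_zero, div_one] at this
      exact this
    refine tendsto_of_tendsto_of_tendsto_of_le_of_le' B A ?_ ?_
    · filter_upwards [ev1, ev2, ev3] with y h1 h2 h3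
      have hn : (3:ℝ) ≤ y.1 := by exact_mod_cast h1
      have hp : 0 < 1 - y.2/y.1 := by linarith
      have := Real.one_sub_inv_le_log_of_pos hp
      have hm := mul_le_mul_of_nonneg_left this (by linarith : 0 ≤ ((y.1:ℝ) - 3)/2)
      refine le_trans (le_of_eq ?_) hm
      have hn0 : (y.1:ℝ) ≠ 0 := by positivity
      have e : 1 - (1 - y.2/y.1)⁻¹ = -(y.2/y.1) / (1 - y.2/y.1)   := by
        rw [eq_div_iff hp.ne', sub_mul, inv_mul_cancel₀ hp.ne']
        ring
      rw [e, ← mul_div_assoc]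
      congr 1
      field_simp
    · filter_upwards [ev1, ev2, ev3] with y h1 h2 h3
      have hn : (3:ℝ) ≤ y.1 := by exact_mod_cast h1
      have hp : 0 < 1 - y.2/y.1 := by linarith
      have := Real.log_le_sub_one_of_pos hp
      have hm := mul_le_mul_of_nonneg_left this (by linarith : 0 ≤ ((y.1:ℝ) - 3)/2)
      refine hm.trans (le_of_eq ?_)
      have hn0 : (y.1:ℝ) ≠ 0 := by positivity
      field_simp
      ring
  have T2 : Tendsto (fun y : ℕ × ℝ => Real.log y.2) (atTop ×ˢ 𝓝 l0) (𝓝 (Real.log l0)) :=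
    tl.log hl0.ne'
  have T3 := stirling_lim.comp tn
  have hs0 : 0 < q / l0 := by positivity
  have Ts : Tendsto (fun y : ℕ × ℝ => q * (1 - y.2/y.1) / y.2) (atTop ×ˢ 𝓝 l0) (𝓝 (q/l0)) := by
    have := ((tp.const_sub 1).const_mul q).div tl hl0.ne'
    rw [sub_zero, mul_one] at this
    exact this
  have T4 : Tendsto (fun y : ℕ × ℝ => LF a y.1 (y.1 * (q * (1 - y.2/y.1) / y.2)) / y.1)
      (atTop ×ˢ 𝓝 l0) (𝓝 (hl a (q/l0))) := by
    have base := (hl_tendsto a ha (q/l0) hs0).comp tn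
    have d : Tendsto (fun y : ℕ × ℝ => LF a y.1 (y.1 * (q * (1 - y.2/y.1) / y.2)) / y.1 -
        LF a y.1 (y.1 * (q/l0)) / y.1) (atTop ×ˢ 𝓝 l0) (𝓝 0) := by
      apply squeeze_zero_norm' (a := fun y : ℕ × ℝ =>
        |Real.log (q * (1 - y.2/y.1) / y.2) - Real.log (q/l0)|)
      · filter_upwards [ev1, ev2, ev3] with y h1 h2 h3
        have hp : 0 < 1 - y.2/y.1 := by linarith
        exact LF_dist a ha y.1 (by omega) _ _ (by positivity) hs0
      · have := ((Ts.log hs0.ne').sub_const (Real.log (q/l0))).abs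
        simpa using this
    have := d.add base
    rw [zero_add] at this
    refine this.congr fun y => ?_
    simp [Function.comp]
  have fin := ((T1.add T2).sub T3).add T4
  refine fin.congr' ?_
  filter_upwards [ev1, ev2, ev3] with y h1 h2 h3
  have hn0 : (0:ℝ) < y.1 := by exact_mod_cast (by omega : 0 < y.1)
  rw [logZ_eq a ha y.1 y.2 q hq h2 ((div_lt_one hn0).1 h3)]
  rfl

lemma psi_neg {x : ℝ} (hx : 1 ≤ x) : Real.log x ≤ (x - 1/x)/2 := by
  let f : ℝ → ℝ := fun x => (x - 1/x)/2 - Real.log x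
  have hd : ∀ x : ℝ, 1 ≤ x → HasDerivAt f ((1 - 1/x)^2/2) x := by
    intro x hx
    have hx0 : x ≠ 0 := by positivity
    have h := (((hasDerivAt_id x).sub (hasDerivAt_inv hx0)).div_const 2).sub (Real.hasDerivAt_log hx0)
    have h' : HasDerivAt f _ x := h.congr_of_eventuallyEq (by
      filter_upwards with z
      simp [f])
    convert h' using 1
    field_simp
    ring
  have hm : MonotoneOn f (Set.Ici 1) := by
    apply monotoneOn_of_deriv_nonneg (convex_Ici 1)
    · intro x hx; exact (hd x hx).continuousAt.continuousWithinAt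
    · intro x hx
      rw [interior_Ici] at hx
      exact (hd x (le_of_lt hx)).differentiableAt.differentiableWithinAt
    · intro x hx
      rw [interior_Ici] at hx
      rw [(hd x (le_of_lt hx)).deriv]
      positivity
  have := hm (Set.mem_Ici.2 le_rfl) (Set.mem_Ici.2 hx) hx
  simp [f] at this
  rw [one_div]; linarith

lemma value_eq (q lam : ℝ) (hq : 0 < q) (hl0 : 0 < lam) :
    -lam/2 + Real.log lam - 1 + hl (fun _ => True) (q/lam) =
      Psi (lam / q) - ((q - 1) / (2 * q)) * lam + Real.log q := by
  unfold Psi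
  rcases lt_trichotomy lam q with h | h | h
  · have hx : 1 < q / lam := (one_lt_div hl0).2 h
    rw [hl_big _ hx]
    have := psi_neg hx.le
    rw [Real.log_div hq.ne' hl0.ne'] at this
    rw [min_eq_right, Real.log_div hq.ne' hl0.ne']
    · field_simp; ring
    · rw [Real.log_div hl0.ne' hq.ne']
      have e : q/lam - 1/(q/lam) = -(lam/q - 1/(lam/q)) := by field_simp; ring
      rw [e] at this
      linarith
  · subst h
    rw [div_self hl0.ne', hl_one]
    simp
    field_simp
    ring
  · have hx : q / lam < 1 := (div_lt_one hl0).2 h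
    rw [hl_small _ (by positivity) hx]
    have := psi_neg ((one_le_div hq).2 h.le)
    rw [min_eq_left (by linarith), Real.log_div hl0.ne' hq.ne']
    field_simp
    ring

lemma Lev_eq (n : ℕ) : Lev n = {F | good (fun _ => True) F} := by
  ext F; simp [Lev, good]

lemma BLev_eq (n r : ℕ) : Bev n r ∩ Lev n = {F | good (fun k => k ≤ r) F} := by
  ext F
  simp only [Bev, Lev, good, Set.mem_inter_iff, Set.mem_ofPred_eq, Nat.cast_le]
  exact and_comm

lemma hl_r_tendsto (s : ℝ) (hs : 0 < s) :
    Tendsto (fun r : ℕ => hl (fun k => k ≤ r) s) atTop (𝓝 (hl (fun _ => True) s)) := by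
  refine tendsto_of_tendsto_of_tendsto_of_le_of_le' (hl_tendsto (fun _ => True) trivial s hs)
    tendsto_const_nhds ?_ ?_
  · filter_upwards [eventually_ge_atTop 1] with r hr
    have := hl_ge (fun k => k ≤ r) hr s hs r hr
    rw [LF, FG_large r r le_rfl] at this
    exact this
  · filter_upwards [eventually_ge_atTop 1] with r hr
    exact hl_mono_a _ _ hr (fun _ _ => trivial) s hs

lemma target_cont (q lam : ℝ) (hq : 0 < q) (hl0 : 0 < lam) :
    ContinuousAt (fun lam => Psi (lam / q) - ((q - 1) / (2 * q)) * lam + Real.log q) lam := by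
  unfold Psi
  have h1 : lam / q ≠ 0 := by positivity
  have h2 : q ≠ 0 := hq.ne'
  fun_prop (disch := assumption)

lemma joint_L (q : ℝ) (hq : 0 < q) (l0 : ℝ) (hl0 : 0 < l0) :
    Tendsto (fun y : ℕ × ℝ => (1/(y.1:ℝ)) * Real.log (Zrc y.1 y.2 q (Lev y.1)))
      (atTop ×ˢ 𝓝 l0) (𝓝 (Psi (l0 / q) - ((q - 1) / (2 * q)) * l0 + Real.log q)) := by
  have := joint (fun _ => True) trivial q hq l0 hl0
  rw [value_eq q l0 hq hl0] at this
  simpa only [Lev_eq] using this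

/-- Fix `q > 0`. For every `λ > 0`,
`lim_{n→∞} (1/n) log Z_{n,λ,q}[L] = Ψ(λ/q) − ((q−1)/(2q))λ + log q`, and moreover
`lim_{r→∞} lim_{n→∞} (1/n) log Z_{n,λ,q}[B_r ∩ L]` equals the same value.
The convergence is uniform for `λ` in compact subsets of `(0,∞) ∖ {q}`. -/
theorem stmt3 (q : ℝ) (hq : 0 < q) :
    (∀ lam : ℝ, 0 < lam →
      Tendsto (fun n : ℕ => (1 / (n:ℝ)) * Real.log (Zrc n lam q (Lev n))) atTop
        (𝓝 (Psi (lam / q) - ((q - 1) / (2 * q)) * lam + Real.log q))) ∧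
    (∃ g : ℕ → ℝ → ℝ,
      (∀ lam : ℝ, 0 < lam → ∀ r : ℕ, 1 ≤ r →
        Tendsto (fun n : ℕ =>
            (1 / (n:ℝ)) * Real.log (Zrc n lam q (Bev n r ∩ Lev n))) atTop
          (𝓝 (g r lam))) ∧
      (∀ lam : ℝ, 0 < lam →
        Tendsto (fun r : ℕ => g r lam) atTop
          (𝓝 (Psi (lam / q) - ((q - 1) / (2 * q)) * lam + Real.log q)))) ∧
    ∀ C : Set ℝ, IsCompact C → C ⊆ Set.Ioi (0:ℝ) \ {q} →
      TendstoUniformlyOn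
        (fun (n : ℕ) (lam : ℝ) => (1 / (n:ℝ)) * Real.log (Zrc n lam q (Lev n)))
        (fun lam => Psi (lam / q) - ((q - 1) / (2 * q)) * lam + Real.log q) atTop C := by
  have slice : ∀ lam : ℝ, Tendsto (fun n : ℕ => (n, lam)) atTop (atTop ×ˢ 𝓝 lam) := fun lam =>
    tendsto_id.prodMk tendsto_const_nhds
  refine ⟨?_, ?_, ?_⟩
  · intro lam hlam
    exact ((joint_L q hq lam hlam).comp (slice lam)).congr fun n => rfl
  · refine ⟨fun r lam => -lam/2 + Real.log lam - 1 + hl (fun k => k ≤ r) (q/lam), ?_, ?_⟩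
    · intro lam hlam r hr
      have := (joint (fun k => k ≤ r) hr q hq lam hlam).comp (slice lam)
      refine this.congr fun n => ?_
      rw [BLev_eq]
      rfl
    · intro lam hlam
      rw [← value_eq q lam hq hlam]
      exact (hl_r_tendsto (q/lam) (by positivity)).const_add _
  · intro C hC hCs
    rw [← tendstoLocallyUniformlyOn_iff_tendstoUniformlyOn_of_compact hC,
      tendstoLocallyUniformlyOn_iff_forall_tendsto]
    intro x hx
    have hx0 : 0 < x := (hCs hx).1
    have hle : (atTop : Filter ℕ) ×ˢ 𝓝[C] x ≤ atTop ×ˢ 𝓝 x :=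
      Filter.prod_mono le_rfl nhdsWithin_le_nhds
    have h1 := (joint_L q hq x hx0).mono_left hle
    have h2 : Tendsto (fun y : ℕ × ℝ => Psi (y.2 / q) - ((q - 1) / (2 * q)) * y.2 + Real.log q)
        (atTop ×ˢ 𝓝[C] x) (𝓝 (Psi (x / q) - ((q - 1) / (2 * q)) * x + Real.log q)) :=
      ((target_cont q x hq hx0).tendsto.comp tendsto_snd).mono_left hle
    exact (h2.prodMk_nhds h1).mono_right (nhds_le_uniformity _)
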